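/- arXiv:2605.16261 — 6 statements merged into one kernel-verified Lean document; each statement's English description precedes it below -/
import Mathlib

section
/- There exists a constant c (depending only on V) such that for every integer n, the last string w_n satisfies n − c ≤ C_V(w_n | n) ≤ n + c; that is, C_V(w_n | n) = n − O(1). -/
open scoped Classical ENNReal

/-- Binary strings. -/
abbrev BStr := List Bool

/-- Plain Kolmogorov complexity of `x` with respect to a decompressor `D`
(a partial function from binary strings to binary strings):
the minimal length of a description `p` with `D p = x`. -/
noncomputable def plainC (D : BStr →. BStr) (x : BStr) : ℕ :=
  sInf {n | ∃ p : BStr, p.length = n ∧ x ∈ D p}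

/-- Conditional complexity of `x` given `y` with respect to a two-argument
decompressor `D` (first argument: program, second: condition). -/
noncomputable def condC (D : BStr → BStr →. BStr) (x y : BStr) : ℕ :=
  sInf {n | ∃ p : BStr, p.length = n ∧ x ∈ D p y}

/-- A fixed computable encoding of natural numbers as binary strings. -/
def natStr (n : ℕ) : BStr := Nat.bits n

/-- A fixed computable pairing function on binary strings. -/
def pairStr (x y : BStr) : BStr := natStr (Encodable.encode (x, y))

/-- A fixed computable encoding of triples of binary strings. -/
def tripStr (x y z : BStr) : BStr := natStr (Encodable.encode (x, y, z))

/-- An optimal (universal) plain decompressor `V`: a partial computable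
decompressor whose complexity function is minimal up to an additive constant
among all partial computable decompressors. -/
structure OptimalDecompressor where
  V : BStr →. BStr
  partrec : Partrec V
  onto : ∀ x : BStr, ∃ p : BStr, x ∈ V p
  optimal : ∀ D : BStr →. BStr, Partrec D → ∃ M : ℕ, ∀ x : BStr,
    (∃ p : BStr, x ∈ D p) → plainC V x ≤ plainC D x + M

/-- A universal two-argument decompressor for conditional plain complexity. -/
structure CondOptimalDecompressor where
  Vc : BStr → BStr →. BStr
  partrec : Partrec₂ Vc
  onto : ∀ x y : BStr, ∃ p : BStr, x ∈ Vc p y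
  optimal : ∀ D : BStr → BStr →. BStr, Partrec₂ D → ∃ M : ℕ, ∀ x y : BStr,
    (∃ p : BStr, x ∈ D p y) → condC Vc x y ≤ condC D x y + M

/-- A two-argument decompressor is prefix-free if for each condition `y`
its domain (in the program argument) is prefix-free. -/
def PrefixFreeDom (D : BStr → BStr →. BStr) : Prop :=
  ∀ y p q : BStr, (D p y).Dom → (D q y).Dom → p <+: q → p = q

/-- A universal prefix-free conditional decompressor, defining conditional
prefix complexity `K(x | y)`. -/
structure UniversalPrefixDecompressor where
  D : BStr → BStr →. BStr
  partrec : Partrec₂ D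
  prefixFree : PrefixFreeDom D
  onto : ∀ x y : BStr, ∃ p : BStr, x ∈ D p y
  universal : ∀ D' : BStr → BStr →. BStr, Partrec₂ D' → PrefixFreeDom D' →
    ∃ c : ℕ, ∀ x y : BStr, (∃ p : BStr, x ∈ D' p y) →
      condC D x y ≤ condC D' x y + c

/-- Conditional prefix complexity `K(x | y)` with respect to a universal
prefix-free conditional decompressor `U`. -/
noncomputable def K (U : UniversalPrefixDecompressor) (x y : BStr) : ℕ := condC U.D x y

/-- The canonical enumeration of all pairs `(x, k)` with `C_V(x) ≤ k`,
obtained by dovetailing the computations of `V` on all programs: a computable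
listing whose range is exactly the set of such pairs. -/
structure CanonicalEnum (V : BStr →. BStr) where
  e : ℕ → Option (BStr × ℕ)
  computable : Computable e
  mem_iff : ∀ x : BStr, ∀ k : ℕ, (∃ t, e t = some (x, k)) ↔ plainC V x ≤ k

/-- The moment of first appearance of string `x` in the canonical enumeration
as a pair `(x, k)` with `k ≤ n`. -/
noncomputable def strFirst {V : BStr →. BStr} (E : CanonicalEnum V) (x : BStr) (n : ℕ) : ℕ :=
  sInf {t | ∃ k ≤ n, E.e t = some (x, k)}

/-- `w` is the last string of complexity at most `n` (i.e. `w = w_n`):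
it has `C_V(w) ≤ n` and every string of complexity at most `n` appears
(as a pair with bound `≤ n`) no later than `w` does. -/
def IsLastSimple (O : OptimalDecompressor) (E : CanonicalEnum O.V) (n : ℕ) (w : BStr) : Prop :=
  plainC O.V w ≤ n ∧ ∀ x : BStr, plainC O.V x ≤ n → strFirst E x n ≤ strFirst E w n

/-- The extension set `T_t(y) = { s : C_V(y, s) ≤ 2^t }`. -/
def Tset (O : OptimalDecompressor) (t : ℕ) (y : BStr) : Set BStr :=
  {s | plainC O.V (pairStr y s) ≤ 2 ^ t}

/-- The relaxed extension set `T_t^δ(y) = { s : C_V(y, s) ≤ 2^t + δ }`. -/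
def TsetR (O : OptimalDecompressor) (t δ : ℕ) (y : BStr) : Set BStr :=
  {s | plainC O.V (pairStr y s) ≤ 2 ^ t + δ}

/-- The "past" set `St^w_t(y)`: extensions `s` with `C_V(y, s) ≤ 2^t` whose
pair appears in the canonical enumeration (with bound `≤ 2^t`) strictly
before `w = w_n` appears (with bound `≤ n`). -/
def StSet (O : OptimalDecompressor) (E : CanonicalEnum O.V) (t n : ℕ) (w : BStr)
    (y : BStr) : Set BStr :=
  {s | plainC O.V (pairStr y s) ≤ 2 ^ t ∧
       strFirst E (pairStr y s) (2 ^ t) < strFirst E w n}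

/-- The tower sequence `a_0 = 1`, `a_{i+1} = 2^{a_i}`. -/
def tower : ℕ → ℕ
  | 0 => 1
  | i + 1 => 2 ^ tower i

/-- `qt` is a structural witness for `q` relative to `n` with constant `c₀`:
it is short, effectively encodes `q`, and satisfies the complexity
decomposition `K(q̃ | n) = K(q̃, α, K(q̃, α | q) | n) + O(1)` where `α = K(q̃ | n)`. -/
def StructuralWitness (Oc : CondOptimalDecompressor) (U : UniversalPrefixDecompressor)
    (c₀ n q : ℕ) (qt : BStr) : Prop :=
  qt.length ≤ c₀ * Nat.log 2 q ∧
  condC Oc.Vc (natStr q) qt ≤ c₀ ∧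
  K U qt (natStr n) ≤
      K U (tripStr qt (natStr (K U qt (natStr n)))
        (natStr (K U (pairStr qt (natStr (K U qt (natStr n)))) (natStr q)))) (natStr n) + c₀ ∧
  K U (tripStr qt (natStr (K U qt (natStr n)))
        (natStr (K U (pairStr qt (natStr (K U qt (natStr n)))) (natStr q)))) (natStr n) ≤
      K U qt (natStr n) + c₀

namespace LastSimple

/-- One step of the computation of `Nat.bits`. -/
def bitsStep (s : ℕ × List Bool) : ℕ × List Bool :=
  if s.1 = 0 then s else (s.1 / 2, s.2 ++ [decide (s.1 % 2 = 1)])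

theorem bitsStep_iterate (k : ℕ) : ∀ (m : ℕ) (acc : List Bool), m ≤ k →
    bitsStep^[k] (m, acc) = (0, acc ++ Nat.bits m) := by
  induction k with
  | zero =>
    intro m acc h
    obtain rfl : m = 0 := by omega
    simp
  | succ k ih =>
    intro m acc h
    rw [Function.iterate_succ_apply]
    by_cases hm : m = 0
    · subst hm
      have h0 : bitsStep (0, acc) = (0, acc) := by simp [bitsStep]
      rw [h0]
      exact ih 0 acc (by omega)
    · have h1 : bitsStep (m, acc) = (m / 2, acc ++ [decide (m % 2 = 1)]) := by
        simp [bitsStep, hm]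
      rw [h1, ih _ _ (by omega)]
      have h2 : Nat.bits m = decide (m % 2 = 1) :: Nat.bits (m / 2) := by
        have hb : m = Nat.bit (decide (m % 2 = 1)) (m / 2) := by
          rw [Nat.bit_val]
          rcases Nat.mod_two_eq_zero_or_one m with h | h <;> simp [h] <;> omega
        conv_lhs => rw [hb]
        rw [Nat.bits_append_bit]
        intro h0
        have : m = 1 := by omega
        simp [this]
      rw [h2]
      simp

theorem primrec_bitsStep : Primrec bitsStep := by
  unfold bitsStep
  refine Primrec.ite (Primrec.eq.comp Primrec.fst (Primrec.const 0)) Primrec.id ?_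
  refine Primrec.pair (Primrec.nat_div.comp Primrec.fst (Primrec.const 2)) ?_
  refine Primrec.list_append.comp Primrec.snd ?_
  refine Primrec.list_cons.comp ?_ (Primrec.const [])
  exact PrimrecPred.decide (Primrec.eq.comp
    (Primrec.nat_mod.comp Primrec.fst (Primrec.const 2)) (Primrec.const 1))

theorem primrec_natStr : Primrec natStr := by
  have h : Primrec (fun n : ℕ => (bitsStep^[n] (n, ([] : List Bool))).2) :=
    Primrec.snd.comp (Primrec.nat_iterate Primrec.id
      (Primrec.pair Primrec.id (Primrec.const [])) (primrec_bitsStep.comp Primrec.snd).to₂)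
  refine h.of_eq fun n => ?_
  rw [bitsStep_iterate n n [] le_rfl]
  simp [natStr]

/-- The unary header of a program. -/
def hdr (q : BStr) : ℕ := q.findIdx (fun b => !b)

/-- The program after the header. -/
def rst (q : BStr) : BStr := List.tail^[hdr q + 1] q

/-- The number decoded from a program. -/
def num (q : BStr) : ℕ :=
  (rst q).tail.length + (2 * hdr q + bif (rst q).headI then 1 else 0)

theorem primrec_hdr : Primrec hdr :=
  Primrec.list_findIdx Primrec.id (Primrec.not.comp Primrec.snd).to₂

theorem primrec_rst : Primrec rst :=
  Primrec.nat_iterate (Primrec.succ.comp primrec_hdr) Primrec.id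
    (Primrec.list_tail.comp Primrec.snd).to₂

theorem primrec_num : Primrec num := by
  refine Primrec.nat_add.comp (Primrec.list_length.comp (Primrec.list_tail.comp primrec_rst)) ?_
  refine Primrec.nat_add.comp (Primrec.nat_mul.comp (Primrec.const 2) primrec_hdr) ?_
  exact Primrec.cond (Primrec.list_headI.comp primrec_rst) (Primrec.const 1) (Primrec.const 0)

/-- The encoding of a shift `2 * j + b` together with a program `p`. -/
def enc (j : ℕ) (b : Bool) (p : BStr) : BStr := List.replicate j true ++ (false :: b :: p)

theorem hdr_enc (j : ℕ) (b : Bool) (p : BStr) : hdr (enc j b p) = j := by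
  induction j with
  | zero => simp [hdr, enc, List.findIdx_cons]
  | succ j ih =>
    simp only [hdr, enc] at ih
    simp [hdr, enc, List.replicate_succ, List.findIdx_cons, ih]

theorem tail_iterate_enc (j : ℕ) (b : Bool) (p : BStr) :
    List.tail^[j + 1] (enc j b p) = b :: p := by
  induction j with
  | zero => simp [enc]
  | succ j ih =>
    rw [Function.iterate_succ_apply]
    simpa [enc, List.replicate_succ] using ih

theorem rst_enc (j : ℕ) (b : Bool) (p : BStr) : rst (enc j b p) = b :: p := by
  rw [rst, hdr_enc, tail_iterate_enc]

theorem num_enc (j : ℕ) (b : Bool) (p : BStr) :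
    num (enc j b p) = p.length + (2 * j + bif b then 1 else 0) := by
  simp [num, rst_enc, hdr_enc]

/-- Is this entry of the enumeration of the form `(w, k)` with `k ≤ n`? -/
def test (o : Option (BStr × ℕ)) (w : BStr) (n : ℕ) : Bool :=
  Option.casesOn o false fun a => decide (a.1 = w ∧ a.2 ≤ n)

theorem primrec_test : Primrec (fun z : Option (BStr × ℕ) × BStr × ℕ => test z.1 z.2.1 z.2.2) := by
  refine Primrec.option_casesOn Primrec.fst (Primrec.const false) ?_
  refine PrimrecPred.decide (PrimrecPred.and ?_ ?_)
  · exact Primrec.eq.comp (Primrec.fst.comp Primrec.snd)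
      (Primrec.fst.comp (Primrec.snd.comp Primrec.fst))
  · exact Primrec.nat_le.comp (Primrec.snd.comp Primrec.snd)
      (Primrec.snd.comp (Primrec.snd.comp Primrec.fst))

/-- Length of the string in an entry of the enumeration. -/
def olen (o : Option (BStr × ℕ)) : ℕ := Option.casesOn o 0 fun a => a.1.length

theorem primrec_olen : Primrec olen :=
  Primrec.option_casesOn Primrec.id (Primrec.const 0)
    (Primrec.list_length.comp (Primrec.fst.comp Primrec.snd)).to₂

/-- A number exceeding the lengths of all strings appearing before time `t`. -/
def big (e : ℕ → Option (BStr × ℕ)) (t : ℕ) : ℕ :=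
  Nat.rec 1 (fun s ih => ih + olen (e s)) t

theorem computable_big {e : ℕ → Option (BStr × ℕ)} (he : Computable e) : Computable (big e) := by
  have h : Computable₂ (fun (_ : ℕ) (z : ℕ × ℕ) => z.2 + olen (e z.1)) := (Primrec.nat_add.to_comp.comp (Computable.snd.comp Computable.snd)
    (primrec_olen.to_comp.comp (he.comp (Computable.fst.comp Computable.snd)))).to₂
  exact Computable.nat_rec Computable.id (Computable.const 1) h

theorem olen_lt_big (e : ℕ → Option (BStr × ℕ)) (t : ℕ) : ∀ s < t, olen (e s) < big e t := by
  induction t with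
  | zero => intro s h; omega
  | succ t ih =>
    intro s h
    have hs : big e (t + 1) = big e t + olen (e t) := rfl
    have hp : ∀ t, 0 < big e t := by
      intro t
      induction t with
      | zero => exact Nat.one_pos
      | succ t iht =>
        have : big e (t + 1) = big e t + olen (e t) := rfl
        omega
    have := hp t
    rcases Nat.lt_succ_iff_lt_or_eq.mp h with h | h
    · have := ih s h
      omega
    · subst h
      omega

theorem computable_replicate : Computable (fun n : ℕ => List.replicate n true) := by
  have h : Primrec (fun n : ℕ => (List.cons true)^[n] []) :=
    Primrec.nat_iterate Primrec.id (Primrec.const [])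
      (Primrec.list_cons.comp (Primrec.const true) Primrec.snd).to₂
  refine (h.of_eq fun n => ?_).to_comp
  induction n with
  | zero => rfl
  | succ n ih => rw [Function.iterate_succ_apply', ih, List.replicate_succ]

/-- The decompressor producing a string of high complexity. -/
noncomputable def dec (Vc : BStr → BStr →. BStr) (e : ℕ → Option (BStr × ℕ)) : BStr →. BStr :=
  fun q => (Vc (rst q).tail (natStr (num q))).bind fun w =>
    (Nat.rfind fun t => Part.some (test (e t) w (num q))).map fun t =>
      List.replicate (big e (t + 1)) true

theorem partrec_dec {Vc : BStr → BStr →. BStr} (hV : Partrec₂ Vc) {e : ℕ → Option (BStr × ℕ)}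
    (he : Computable e) : Partrec (dec Vc e) := by
  have h1 : Partrec (fun q : BStr => Vc (rst q).tail (natStr (num q))) :=
    Partrec₂.comp hV (Primrec.list_tail.comp primrec_rst).to_comp
      (primrec_natStr.comp primrec_num).to_comp
  have h2 : Computable₂ (fun (z : BStr × BStr) (t : ℕ) => test (e t) z.2 (num z.1)) := by
    have h : Computable (fun y : (BStr × BStr) × ℕ => test (e y.2) y.1.2 (num y.1.1)) :=
      primrec_test.to_comp.comp (Computable.pair (he.comp Computable.snd)
      (Computable.pair (Computable.snd.comp Computable.fst)
        (primrec_num.to_comp.comp (Computable.fst.comp Computable.fst))))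
    exact h.to₂
  have h3 : Computable (fun z : (BStr × BStr) × ℕ =>
      List.replicate (big e (z.2 + 1)) true) :=
    (computable_replicate.comp ((computable_big he).comp
      (Computable.succ.comp Computable.snd)))
  have h4 : Partrec (fun z : BStr × BStr =>
      Nat.rfind fun t => Part.some (test (e t) z.2 (num z.1))) :=
    Partrec.rfind h2.partrec₂
  have h5 : Partrec (fun z : BStr × BStr =>
      (Nat.rfind fun t => Part.some (test (e t) z.2 (num z.1))).map fun t =>
        List.replicate (big e (t + 1)) true) :=
    Partrec.map h4 h3.to₂
  exact Partrec.bind h1 h5.to₂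

end LastSimple

open LastSimple

/-- There exists a constant `c` (depending only on `V`) such that
for every integer `n`, the last string `w_n` satisfies
`n − c ≤ C_V(w_n | n) ≤ n + c`. -/
theorem last_simple_string_complexity
    (O : OptimalDecompressor) (Oc : CondOptimalDecompressor) (E : CanonicalEnum O.V) :
    ∃ c : ℕ, ∀ n : ℕ, ∀ w : BStr, IsLastSimple O E n w →
      n ≤ condC Oc.Vc w (natStr n) + c ∧ condC Oc.Vc w (natStr n) ≤ n + c := by
  obtain ⟨M₁, hM₁⟩ := Oc.optimal (fun p _ => O.V p) (O.partrec.comp Computable.fst)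
  obtain ⟨M₂, hM₂⟩ := O.optimal _ (partrec_dec Oc.partrec E.computable)
  refine ⟨M₁ + (2 * M₂ + 5), fun n w hw => ⟨?_, ?_⟩⟩
  · obtain ⟨hwn, hlast⟩ := hw
    have hne : {m | ∃ p : BStr, p.length = m ∧ w ∈ Oc.Vc p (natStr n)}.Nonempty := by
      obtain ⟨p, hp⟩ := Oc.onto w (natStr n)
      exact ⟨_, p, rfl, hp⟩
    obtain ⟨p, hpl, hp⟩ := Nat.sInf_mem hne
    change p.length = condC Oc.Vc w (natStr n) at hpl
    rw [← hpl]
    by_contra hcon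
    obtain ⟨j, b, hjb⟩ : ∃ (j : ℕ) (b : Bool),
        n = p.length + (2 * j + bif b then 1 else 0) := by
      refine ⟨(n - p.length) / 2, decide ((n - p.length) % 2 = 1), ?_⟩
      rcases Nat.mod_two_eq_zero_or_one (n - p.length) with h | h <;> simp [h] <;> omega
    have hbb : (bif b then 1 else 0) ≤ 1 := by cases b <;> simp
    have hnum : num (enc j b p) = n := by rw [num_enc, ← hjb]
    -- the search terminates
    obtain ⟨t₀, ht₀⟩ := (E.mem_iff w n).2 hwn
    have hdom : (Nat.rfind fun t => Part.some (test (E.e t) w n)).Dom := by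
      refine Nat.rfind_dom.2 ⟨t₀, ?_, fun _ => trivial⟩
      refine Part.mem_some_iff.2 ?_
      simp [ht₀, test]
    obtain ⟨t, ht⟩ := Part.dom_iff_mem.1 hdom
    have htt : test (E.e t) w n = true := by
      exact (Part.mem_some_iff.1 (Nat.rfind_spec ht)).symm
    have hle : strFirst E w n ≤ t := by
      refine Nat.sInf_le ?_
      rcases h : E.e t with _ | ⟨a, k⟩
      · simp [h, test] at htt
      · simp [h, test] at htt
        exact ⟨k, htt.2, by rw [← htt.1]; exact h⟩
    let x : BStr := List.replicate (big E.e (t + 1)) true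
    have hx : x ∈ dec Oc.Vc E.e (enc j b p) := by
      refine Part.mem_bind_iff.2 ⟨w, ?_, ?_⟩
      · rw [hnum, rst_enc]; exact hp
      · rw [hnum]
        exact Part.mem_map _ ht
    have hxn : n < plainC O.V x := by
      by_contra hle'
      have hxle : plainC O.V x ≤ n := by omega
      have h1 : strFirst E x n ≤ t := (hlast x hxle).trans hle
      have hne' : {t | ∃ k ≤ n, E.e t = some (x, k)}.Nonempty := by
        obtain ⟨s, hs⟩ := (E.mem_iff x n).2 hxle
        exact ⟨s, n, le_rfl, hs⟩
      obtain ⟨k, _, hk⟩ := Nat.sInf_mem hne'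
      have h2 := olen_lt_big E.e (t + 1) (strFirst E x n) (by omega)
      change E.e (strFirst E x n) = _ at hk
      rw [hk] at h2
      simp [olen, x] at h2
    have h3 := hM₂ x ⟨_, hx⟩
    have h4 : plainC (dec Oc.Vc E.e) x ≤ (enc j b p).length := Nat.sInf_le ⟨_, rfl, hx⟩
    have h5 : (enc j b p).length = j + (p.length + 2) := by simp [enc]
    omega
  · have h := hM₁ w (natStr n) (O.onto w)
    have h2 : condC (fun p _ => O.V p) w (natStr n) = plainC O.V w := rfl
    have := hw.1
    omega
end

section
/- For every total computable function f with f(n) > n for all n, there exists a constant c such that for every integer n, Rest(n, f(n)) ≤ 2^{f(n) − n + c}, where Rest(n, u) is the number of strings x with C_V(x) ≤ u whose first appearance in the canonical enumeration (as a pair (x, k) with k ≤ u) occurs after the appearance of w_n. -/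
open scoped Classical ENNReal

/-- `Rest(n, u)`: the set of strings `x` with `C_V(x) ≤ u` whose first
appearance in the canonical enumeration (as a pair `(x, k)` with `k ≤ u`)
occurs after the appearance of `w_n`. -/
def RestSet (O : OptimalDecompressor) (E : CanonicalEnum O.V) (n u : ℕ) (w : BStr) :
    Set BStr :=
  {x | plainC O.V x ≤ u ∧ strFirst E w n < strFirst E x u}


namespace TailUB

/-- Value of a binary string. -/
def val (b : BStr) (s : ℕ) : ℕ := b.foldr (fun x a => 2 * a + x.toNat) s

theorem val_surj : ∀ m b : ℕ, b < 2 ^ m → ∃ p : BStr, p.length = m ∧ val p 0 = b := by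
  intro m
  induction m with
  | zero => intro b hb; exact ⟨[], rfl, by simp only [pow_zero] at hb; simp only [val, List.foldr_nil]; omega⟩
  | succ m ih =>
    intro b hb
    obtain ⟨p, hp, hv⟩ := ih (b / 2) (by rw [pow_succ] at hb; omega)
    refine ⟨(b % 2 == 1) :: p, by simp [hp], ?_⟩
    simp only [val, List.foldr_cons] at hv ⊢
    rw [hv]
    rcases Nat.mod_two_eq_zero_or_one b with h | h <;> simp [h] <;> omega

theorem val_lt : ∀ p : BStr, 1 ≤ val p 1 ∧ val p 1 < 2 ^ (p.length + 1) := by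
  intro p
  induction p with
  | nil => simp [val]
  | cons x p ih =>
    simp only [val, List.foldr_cons, List.length_cons] at ih ⊢
    have := Bool.toNat_le x
    rw [pow_succ]; omega

theorem val_inj : ∀ p q : BStr, val p 1 = val q 1 → p = q := by
  intro p
  induction p with
  | nil =>
    intro q h
    cases q with
    | nil => rfl
    | cons y q =>
      have := (val_lt q).1
      simp only [val, List.foldr_cons, List.foldr_nil] at h this
      omega
  | cons x p ih =>
    intro q h
    cases q with
    | nil =>
      have := (val_lt p).1
      simp only [val, List.foldr_cons, List.foldr_nil] at h this
      omega
    | cons y q =>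
      simp only [val, List.foldr_cons] at h
      have hx := Bool.toNat_le x
      have hy := Bool.toNat_le y
      have h1 : val p 1 = val q 1 := by simp only [val]; omega
      have h2 : x.toNat = y.toNat := by omega
      rw [ih q h1]
      cases x <;> cases y <;> simp_all

theorem simple_finite (O : OptimalDecompressor) (u : ℕ) :
    {x | plainC O.V x ≤ u}.Finite ∧ {x | plainC O.V x ≤ u}.ncard < 2 ^ (u + 1) := by
  have h : ∀ x, ∃ p : BStr, p.length = plainC O.V x ∧ x ∈ O.V p := fun x =>
    Nat.sInf_mem (s := {n | ∃ p : BStr, p.length = n ∧ x ∈ O.V p})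
      (by obtain ⟨p, hp⟩ := O.onto x; exact ⟨_, p, rfl, hp⟩)
  choose g hg1 hg2 using h
  have hinj : Set.InjOn (fun x => val (g x) 1) {x | plainC O.V x ≤ u} := by
    intro x _ y _ hxy
    have := val_inj _ _ hxy
    have h1 := hg2 x
    rw [this] at h1
    exact Part.mem_unique h1 (hg2 y)
  have hm : Set.MapsTo (fun x => val (g x) 1) {x | plainC O.V x ≤ u}
      (Finset.Ico 1 (2 ^ (u + 1)) : Finset ℕ) := by
    intro x hx
    have := val_lt (g x)
    have h2 : 2 ^ ((g x).length + 1) ≤ 2 ^ (u + 1) := by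
      apply Nat.pow_le_pow_right (by norm_num)
      rw [hg1]; simpa using hx
    simp; omega
  refine ⟨Set.Finite.of_injOn hm hinj (Finset.finite_toSet _), ?_⟩
  have := Set.ncard_le_ncard_of_injOn _ hm hinj (Finset.finite_toSet _)
  rw [Set.ncard_coe_finset] at this
  simp at this
  have : 0 < 2 ^ (u + 1) := by positivity
  omega

/-- One step of the listing. -/
def step (u : ℕ) (L : List BStr) (y : BStr × ℕ) : List BStr :=
  if y.2 ≤ u then (if @List.idxOf BStr instBEqOfDecidableEq y.1 L < L.length then L else y.1 :: L) else L

/-- Distinct strings listed with bound at most `u` before time `t`. -/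
def lst (e : ℕ → Option (BStr × ℕ)) (u t : ℕ) : List BStr :=
  Nat.rec (motive := fun _ => List BStr) []
    (fun s L => Option.casesOn (e s) L (fun y => step u L y)) t

theorem lst_succ (e : ℕ → Option (BStr × ℕ)) (u t : ℕ) :
    lst e u (t + 1) = Option.casesOn (e t) (lst e u t) (fun y => step u (lst e u t) y) := rfl

theorem mem_step (u : ℕ) (L : List BStr) (y : BStr × ℕ) (x : BStr) :
    x ∈ step u L y ↔ x ∈ L ∨ (y.2 ≤ u ∧ x = y.1) := by
  unfold step
  simp only [List.idxOf_lt_length_iff]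
  split_ifs with h1 h2
  · constructor
    · exact Or.inl
    · rintro (h | ⟨_, rfl⟩) <;> assumption
  · simp [h1, or_comm]
  · simp [h1]

theorem nodup_step (u : ℕ) (L : List BStr) (y : BStr × ℕ) (h : L.Nodup) : (step u L y).Nodup := by
  unfold step
  simp only [List.idxOf_lt_length_iff]
  split_ifs with h1 h2 <;> simp_all

theorem len_step (u : ℕ) (L : List BStr) (y : BStr × ℕ) : L.length ≤ (step u L y).length := by
  unfold step
  split_ifs <;> simp

theorem mem_lst (e : ℕ → Option (BStr × ℕ)) (u t : ℕ) (x : BStr) :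
    x ∈ lst e u t ↔ ∃ s < t, ∃ k ≤ u, e s = some (x, k) := by
  induction t with
  | zero => simp [lst]
  | succ t ih =>
    rw [lst_succ]
    have key : (∃ s < t + 1, ∃ k ≤ u, e s = some (x, k)) ↔
        (∃ s < t, ∃ k ≤ u, e s = some (x, k)) ∨ ∃ k ≤ u, e t = some (x, k) := by
      constructor
      · rintro ⟨s, hs, h⟩
        rcases Nat.lt_succ_iff_lt_or_eq.1 hs with h' | rfl
        · exact Or.inl ⟨s, h', h⟩
        · exact Or.inr h
      · rintro (⟨s, hs, h⟩ | h)
        · exact ⟨s, by omega, h⟩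
        · exact ⟨t, by omega, h⟩
    rw [key]
    rcases he : e t with _ | ⟨y, k⟩
    · simp [ih]
    · simp only [mem_step, ih, Option.some.injEq, Prod.mk.injEq]
      apply or_congr Iff.rfl
      constructor
      · rintro ⟨h, rfl⟩; exact ⟨k, h, rfl, rfl⟩
      · rintro ⟨k', h, rfl, rfl⟩; exact ⟨h, rfl⟩

theorem nodup_lst (e : ℕ → Option (BStr × ℕ)) (u t : ℕ) : (lst e u t).Nodup := by
  induction t with
  | zero => simp [lst]
  | succ t ih =>
    rw [lst_succ]
    rcases e t with _ | y
    · exact ih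
    · exact nodup_step _ _ _ ih

theorem len_mono (e : ℕ → Option (BStr × ℕ)) (u : ℕ) : Monotone fun t => (lst e u t).length := by
  apply monotone_nat_of_le_succ
  intro t
  simp only [lst_succ]
  rcases e t with _ | y
  · exact le_rfl
  · exact len_step _ _ _

theorem step_primrec : Primrec fun a : (ℕ × List BStr) × (BStr × ℕ) => step a.1.1 a.1.2 a.2 := by
  unfold step
  have h1 : Primrec fun a : (ℕ × List BStr) × (BStr × ℕ) => a.1.2 := Primrec.snd.comp Primrec.fst
  have h2 : Primrec fun a : (ℕ × List BStr) × (BStr × ℕ) => a.2.1 := Primrec.fst.comp Primrec.snd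
  refine Primrec.ite (Primrec.nat_le.comp (Primrec.snd.comp Primrec.snd)
    (Primrec.fst.comp Primrec.fst)) (Primrec.ite ?_ h1 (Primrec.list_cons.comp h2 h1)) h1
  exact Primrec.nat_lt.comp (Primrec.list_idxOf.comp h2 h1) (Primrec.list_length.comp h1)

theorem step_comp {α : Type} [Primcodable α] {u : α → ℕ} {L : α → List BStr} {y : α → BStr × ℕ}
    (hu : Computable u) (hL : Computable L) (hy : Computable y) :
    Computable fun a => step (u a) (L a) (y a) :=
  Computable.comp (f := fun a : (ℕ × List BStr) × (BStr × ℕ) => step a.1.1 a.1.2 a.2)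
    (g := fun a => ((u a, L a), y a)) step_primrec.to_comp ((hu.pair hL).pair hy)

theorem step_computable₂ : Computable₂ fun (a : (ℕ × ℕ) × (ℕ × List BStr)) (y : BStr × ℕ) =>
    step a.1.1 a.2.2 y := by
  have h1 : Computable fun a : ((ℕ × ℕ) × (ℕ × List BStr)) × (BStr × ℕ) => a.1.1.1 :=
    Computable.fst.comp (Computable.fst.comp Computable.fst)
  have h2 : Computable fun a : ((ℕ × ℕ) × (ℕ × List BStr)) × (BStr × ℕ) => a.1.2.2 :=
    Computable.snd.comp (Computable.snd.comp Computable.fst)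
  have h3 : Computable fun a : ((ℕ × ℕ) × (ℕ × List BStr)) × (BStr × ℕ) => a.2 :=
    Computable.snd
  exact (step_comp h1 h2 h3).to₂

theorem step_option_computable {e : ℕ → Option (BStr × ℕ)} (he : Computable e) :
    Computable fun q : (ℕ × ℕ) × (ℕ × List BStr) =>
      (Option.casesOn (e q.2.1) q.2.2 (fun y => step q.1.1 q.2.2 y) : List BStr) := by
  have ho : Computable fun a : (ℕ × ℕ) × (ℕ × List BStr) => e a.2.1 :=
    he.comp (Computable.fst.comp Computable.snd)
  have hl : Computable fun a : (ℕ × ℕ) × (ℕ × List BStr) => a.2.2 :=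
    Computable.snd.comp Computable.snd
  exact Computable.option_casesOn ho hl step_computable₂

/-- One step of the listing, as a function. -/
def ostep (e : ℕ → Option (BStr × ℕ)) (a : ℕ × ℕ) (q : ℕ × List BStr) : List BStr :=
  Option.casesOn (e q.1) q.2 (fun y => step a.1 q.2 y)

theorem ostep_computable {e : ℕ → Option (BStr × ℕ)} (he : Computable e) :
    Computable₂ (ostep e) := step_option_computable he

theorem lst_computable {e : ℕ → Option (BStr × ℕ)} (he : Computable e) :
    Computable fun a : ℕ × ℕ => lst e a.1 a.2 := by
  have := Computable.nat_rec (f := fun a : ℕ × ℕ => a.2) (g := fun _ => ([] : List BStr))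
    Computable.snd (Computable.const []) (ostep_computable he)
  exact this

theorem val_primrec : Primrec fun p : BStr => val p 0 := by
  unfold val
  refine Primrec.list_foldr (h := fun (_ : BStr) (q : Bool × ℕ) => 2 * q.2 + q.1.toNat)
    Primrec.id (Primrec.const 0) ?_
  exact Primrec.nat_add.comp
    (Primrec.nat_mul.comp (Primrec.const 2) (Primrec.snd.comp Primrec.snd))
    ((Primrec.dom_finite Bool.toNat).comp (Primrec.fst.comp Primrec.snd))

theorem pow_primrec : Primrec fun m : ℕ => 2 ^ m := by
  have : Primrec fun m : ℕ => Nat.rec (motive := fun _ => ℕ) 1 (fun _ r => 2 * r) m :=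
    Primrec.nat_rec' (h := fun (_ : ℕ) (q : ℕ × ℕ) => 2 * q.2) Primrec.id (Primrec.const 1)
      (Primrec.nat_mul.comp (Primrec.const 2) (Primrec.snd.comp Primrec.snd))
  refine this.of_eq fun m => ?_
  induction m with
  | zero => rfl
  | succ m ih => rw [pow_succ, ← ih, mul_comm]

def kk (p : BStr) : ℕ := p.idxOf false
def bb (p : BStr) : BStr := p.drop (kk p + 1)
def nn (p : BStr) : ℕ := (bb p).length + (2 * kk p + 1)
def thr (f : ℕ → ℕ) (p : BStr) : ℕ :=
  (val (bb p) 0 + 1) * 2 ^ (f (nn p) - nn p + (2 * kk p + 2))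

theorem kk_primrec : Primrec kk := Primrec.list_idxOf.comp (Primrec.const false) Primrec.id

theorem bb_primrec : Primrec bb :=
  Primrec.list_drop.comp (Primrec.succ.comp kk_primrec) Primrec.id

theorem nn_primrec : Primrec nn :=
  Primrec.nat_add.comp (Primrec.list_length.comp bb_primrec)
    (Primrec.succ.comp (Primrec.nat_mul.comp (Primrec.const 2) kk_primrec))

theorem thr_computable {f : ℕ → ℕ} (hf : Computable f) : Computable (thr f) := by
  have h1 : Computable fun p => val (bb p) 0 + 1 :=
    (Primrec.succ.comp (val_primrec.comp bb_primrec)).to_comp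
  have hn : Computable nn := nn_primrec.to_comp
  have h2 : Computable fun p => f (nn p) - nn p :=
    Primrec.nat_sub.to_comp.comp (hf.comp hn) hn
  have h3 : Computable fun p => 2 * kk p + 2 :=
    (Primrec.nat_add.comp (Primrec.nat_mul.comp (Primrec.const 2) kk_primrec)
      (Primrec.const 2)).to_comp
  exact Primrec.nat_mul.to_comp.comp h1 (pow_primrec.to_comp.comp
    (Primrec.nat_add.to_comp.comp h2 h3))

/-- The auxiliary decompressor. -/
def dec (e : ℕ → Option (BStr × ℕ)) (f : ℕ → ℕ) : BStr →. BStr := fun p =>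
  (Nat.rfind fun t => Part.some (decide (thr f p ≤ (lst e (f (nn p)) t).length))).map
    fun t => true :: (lst e (f (nn p)) t).flatten

theorem dec_partrec {e : ℕ → Option (BStr × ℕ)} (he : Computable e) {f : ℕ → ℕ}
    (hf : Computable f) : Partrec (dec e f) := by
  have hl : Computable fun a : BStr × ℕ => lst e (f (nn a.1)) a.2 :=
    (lst_computable he).comp
      (Computable.pair (hf.comp (nn_primrec.to_comp.comp Computable.fst)) Computable.snd)
  have hc : Computable fun a : BStr × ℕ =>
      decide (thr f a.1 ≤ (lst e (f (nn a.1)) a.2).length) :=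
    Primrec.nat_le.decide.to_comp.comp ((thr_computable hf).comp Computable.fst)
      (Computable.list_length.comp hl)
  refine Partrec.map (Partrec.rfind (p := fun p t =>
    Part.some (decide (thr f p ≤ (lst e (f (nn p)) t).length))) hc) ?_
  exact Computable.list_cons.comp (Computable.const true)
    (Primrec.list_flatten.to_comp.comp hl)

theorem len_flatten {x : BStr} {L : List BStr} (h : x ∈ L) : x.length ≤ L.flatten.length :=
  (List.sublist_flatten_of_mem h).length_le

end TailUB

open TailUB in
/-- For every total computable `f` with `f(n) > n` for all `n`,
there is a constant `c` with `Rest(n, f(n)) ≤ 2^{f(n) − n + c}` for every `n`. -/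
theorem tail_upper_bound
    (O : OptimalDecompressor) (E : CanonicalEnum O.V)
    (f : ℕ → ℕ) (hf : Computable f) (hgt : ∀ n : ℕ, n < f n) :
    ∃ c : ℕ, ∀ n : ℕ, ∀ w : BStr, IsLastSimple O E n w →
      (RestSet O E n (f n) w).Finite ∧
      (RestSet O E n (f n) w).ncard ≤ 2 ^ (f n - n + c) := by
  obtain ⟨M, hM⟩ := O.optimal (dec E.e f) (dec_partrec E.computable hf)
  refine ⟨2 * M + 2, fun n w hw => ?_⟩
  obtain ⟨hSf, hSc⟩ := simple_finite O (f n)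
  have hn := hgt n
  have hsub : RestSet O E n (f n) w ⊆ {x | plainC O.V x ≤ f n} := fun x hx => hx.1
  have hRf := hSf.subset hsub
  refine ⟨hRf, ?_⟩
  by_contra! hbig
  have hRS := Set.ncard_le_ncard hsub hSf
  have first_spec : ∀ x u, plainC O.V x ≤ u → ∃ k ≤ u, E.e (strFirst E x u) = some (x, k) := by
    intro x u hx
    obtain ⟨t, ht⟩ := (E.mem_iff x u).2 hx
    exact Nat.sInf_mem (s := {t | ∃ k ≤ u, E.e t = some (x, k)}) ⟨t, u, le_rfl, ht⟩
  by_cases hnc : n < 2 * M + 2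
  · have : 2 ^ (f n + 1) ≤ 2 ^ (f n - n + (2 * M + 2)) :=
      Nat.pow_le_pow_right (by norm_num) (by omega)
    omega
  set u := f n with hu
  set tw := strFirst E w n with htw
  set B := 2 ^ (u - n + (2 * M + 2)) with hB
  have hBpos : 0 < B := by positivity
  set A := (lst E.e u (tw + 1)).length with hA
  have hcount : A + (RestSet O E n u w).ncard ≤ {x | plainC O.V x ≤ u}.ncard := by
    have h1 : ((lst E.e u (tw + 1)).toFinset : Set BStr).ncard = A := by
      rw [Set.ncard_coe_finset, List.toFinset_card_of_nodup (nodup_lst _ _ _)]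
    rw [← h1, ← Set.ncard_union_eq ?_ (Finset.finite_toSet _) hRf]
    · apply Set.ncard_le_ncard _ hSf
      apply Set.union_subset _ hsub
      intro x hx
      simp only [List.coe_toFinset, Set.mem_ofPred_eq, mem_lst] at hx
      obtain ⟨s, _, k, hk, hs⟩ := hx
      exact le_trans ((E.mem_iff x k).1 ⟨s, hs⟩) hk
    · rw [Set.disjoint_left]
      intro x hx hx2
      simp only [List.coe_toFinset, Set.mem_ofPred_eq, mem_lst] at hx
      obtain ⟨s, hs1, k, hk, hs⟩ := hx
      have : strFirst E x u ≤ s := Nat.sInf_le ⟨k, hk, hs⟩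
      have := hx2.2
      omega
  set b := A / B with hb
  have hb1 : b * B ≤ A := Nat.div_mul_le_self _ _
  have hb2 : A < (b + 1) * B := by
    rw [hb, mul_comm]; exact Nat.lt_mul_div_succ A hBpos
  have hblt : b < 2 ^ (n - (2 * M + 1)) := by
    have h2 : 2 ^ (u + 1) = 2 ^ (n - (2 * M + 1)) * B := by
      rw [hB, ← pow_add]; congr 1; omega
    have h3 : b * B < 2 ^ (n - (2 * M + 1)) * B := by omega
    exact lt_of_mul_lt_mul_right h3 (Nat.zero_le _)
  obtain ⟨q, hq1, hq2⟩ := val_surj _ _ hblt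
  set p : BStr := List.replicate M true ++ false :: q with hp
  have hk : kk p = M := by
    rw [kk, hp, List.idxOf_append_of_notMem (by simp)]; simp
  have hbb : bb p = q := by
    rw [bb, hk, hp, ← List.drop_drop]
    rw [List.drop_left' (by simp)]; rfl
  have hnn : nn p = n := by rw [nn, hbb, hk, hq1]; omega
  have hthr : thr f p = (b + 1) * B := by rw [thr, hbb, hnn, hk, hq2]
  -- the search terminates
  obtain ⟨T0, hT0⟩ : ∃ T, (b + 1) * B ≤ (lst E.e u T).length := by
    obtain ⟨T, hT⟩ := (hSf.image fun x => strFirst E x u).bddAbove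
    refine ⟨T + 1, ?_⟩
    have h1 : {x | plainC O.V x ≤ u} ⊆ ((lst E.e u (T + 1)).toFinset : Set BStr) := by
      intro x hx
      simp only [List.coe_toFinset, Set.mem_ofPred_eq, mem_lst]
      exact ⟨_, Nat.lt_succ_of_le (hT ⟨x, hx, rfl⟩), first_spec x u hx⟩
    have h2 := Set.ncard_le_ncard h1 (Finset.finite_toSet _)
    rw [Set.ncard_coe_finset, List.toFinset_card_of_nodup (nodup_lst _ _ _)] at h2
    rw [add_mul, one_mul]; omega
  obtain ⟨T, hT, -⟩ := Nat.rfind_min' (p := fun t => decide (thr f p ≤ (lst E.e u t).length))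
    (m := T0) (by rw [hthr]; simpa using hT0)
  have hTlen : (b + 1) * B ≤ (lst E.e u T).length := by
    have := Nat.rfind_spec hT
    rw [hthr] at this
    simpa using this
  have hTtw : tw + 1 ≤ T := by
    by_contra! h
    have := len_mono E.e u h.le
    simp only at this
    omega
  set y : BStr := true :: (lst E.e u T).flatten with hy
  have hyD : y ∈ dec E.e f p := by
    rw [dec, hnn]
    exact Part.mem_map _ hT
  have hyn : plainC O.V y ≤ n := by
    refine (hM y ⟨p, hyD⟩).trans ?_
    have : plainC (dec E.e f) y ≤ p.length := Nat.sInf_le ⟨p, rfl, hyD⟩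
    have hpl : p.length = M + (n - (2 * M + 1) + 1) := by simp [hp, hq1]
    omega
  have hlast := hw.2 y hyn
  obtain ⟨k, hkn, hke⟩ := first_spec y n hyn
  have hmem : y ∈ lst E.e u T := by
    rw [mem_lst]
    exact ⟨_, by omega, k, by omega, hke⟩
  have := len_flatten hmem
  simp [hy] at this
end

section
/- There exists a constant c₁ (depending only on V) such that for every integer n, Rest(n, 2^n) ≤ c₁ · 2^{2^n − n}, where Rest(n, 2^n) is the number of strings x with C_V(x) ≤ 2^n whose first appearance in the canonical enumeration (as a pair (x, k) with k ≤ 2^n) occurs after the appearance of w_n. -/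
open scoped Classical ENNReal

/-! ### Auxiliary material for the proof -/

namespace TailBound

/-- One step of the decoder of programs `1^j 0 q`. State: (seen the separator, `2j + |q|`,
`|q|`, the number with binary notation `q`). -/
def decStep (s : Bool × ℕ × ℕ × ℕ) (b : Bool) : Bool × ℕ × ℕ × ℕ :=
  bif s.1 then (true, s.2.1 + 1, s.2.2.1 + 1, 2 * s.2.2.2 + (bif b then 1 else 0))
  else bif b then (false, s.2.1 + 2, s.2.2.1, s.2.2.2) else (true, s.2.1, s.2.2.1, s.2.2.2)

def dec (p : BStr) : Bool × ℕ × ℕ × ℕ := p.foldl decStep (false, 0, 0, 0)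

theorem decStep_primrec : Primrec₂ decStep := by
  have s1 : Primrec fun x : (Bool × ℕ × ℕ × ℕ) × Bool => x.1.1 := Primrec.fst.comp Primrec.fst
  have s2 : Primrec fun x : (Bool × ℕ × ℕ × ℕ) × Bool => x.1.2.1 :=
    Primrec.fst.comp (Primrec.snd.comp Primrec.fst)
  have s3 : Primrec fun x : (Bool × ℕ × ℕ × ℕ) × Bool => x.1.2.2.1 :=
    Primrec.fst.comp (Primrec.snd.comp (Primrec.snd.comp Primrec.fst))
  have s4 : Primrec fun x : (Bool × ℕ × ℕ × ℕ) × Bool => x.1.2.2.2 :=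
    Primrec.snd.comp (Primrec.snd.comp (Primrec.snd.comp Primrec.fst))
  have b : Primrec fun x : (Bool × ℕ × ℕ × ℕ) × Bool => x.2 := Primrec.snd
  have bv : Primrec fun x : (Bool × ℕ × ℕ × ℕ) × Bool => (bif x.2 then 1 else 0 : ℕ) :=
    Primrec.cond b (Primrec.const 1) (Primrec.const 0)
  refine Primrec.cond s1 ?_ (Primrec.cond b ?_ ?_)
  · exact (Primrec.const true).pair ((Primrec.nat_add.comp s2 (Primrec.const 1)).pair
      ((Primrec.nat_add.comp s3 (Primrec.const 1)).pair
        (Primrec.nat_add.comp (Primrec.nat_mul.comp (Primrec.const 2) s4) bv)))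
  · exact (Primrec.const false).pair ((Primrec.nat_add.comp s2 (Primrec.const 2)).pair
      (s3.pair s4))
  · exact (Primrec.const true).pair (s2.pair (s3.pair s4))

theorem dec_primrec : Primrec dec :=
  Primrec.list_foldl Primrec.id (Primrec.const _)
    ((decStep_primrec.comp (Primrec.fst.comp Primrec.snd) (Primrec.snd.comp Primrec.snd)).to₂)

theorem foldl_true (j a l m : ℕ) :
    (List.replicate j true).foldl decStep (false, a, l, m) = (false, a + 2 * j, l, m) := by
  induction j generalizing a with
  | zero => simp
  | succ j ih =>
    rw [List.replicate_succ, List.foldl_cons]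
    simp only [decStep, cond_true, cond_false]
    rw [ih]
    simp; ring

theorem exists_q (a l : ℕ) : ∀ m < 2 ^ l, ∃ q : BStr, q.length = l ∧
    q.foldl decStep (true, a, 0, 0) = (true, a + l, l, m) := by
  induction l with
  | zero => intro m hm; exact ⟨[], by simp at hm ⊢; omega⟩
  | succ l ih =>
    intro m hm
    obtain ⟨q, hq, hf⟩ := ih (m / 2) (by rw [pow_succ] at hm; omega)
    refine ⟨q ++ [decide (m % 2 = 1)], by simp [hq], ?_⟩
    rw [List.foldl_append, hf]
    rcases Nat.mod_two_eq_zero_or_one m with h | h <;> simp [decStep, h] <;> omega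

theorem exists_prog (j l m : ℕ) (hm : m < 2 ^ l) : ∃ p : BStr, p.length = j + 1 + l ∧
    dec p = (true, 2 * j + l, l, m) := by
  obtain ⟨q, hq, hf⟩ := exists_q (2 * j) l m hm
  refine ⟨List.replicate j true ++ false :: q, by simp [hq]; ring, ?_⟩
  rw [dec, List.foldl_append, foldl_true, List.foldl_cons]
  simp only [decStep, cond_false, zero_add]
  exact hf

/-- Add a newly enumerated string to the list of the strings seen so far. -/
def step (B : ℕ) (L : List BStr) (o : Option (BStr × ℕ)) : List BStr :=
  Option.casesOn o L fun q =>
    bif decide (q.2 ≤ B) then (bif decide (@List.idxOf BStr instBEqOfDecidableEq q.1 L < L.length) then L else q.1 :: L) else L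

theorem step_primrec :
    Primrec fun x : (ℕ × List BStr) × Option (BStr × ℕ) => step x.1.1 x.1.2 x.2 := by
  refine Primrec.option_casesOn Primrec.snd (Primrec.snd.comp Primrec.fst) ?_
  have B : Primrec fun y : ((ℕ × List BStr) × Option (BStr × ℕ)) × (BStr × ℕ) => y.1.1.1 :=
    Primrec.fst.comp (Primrec.fst.comp Primrec.fst)
  have L : Primrec fun y : ((ℕ × List BStr) × Option (BStr × ℕ)) × (BStr × ℕ) => y.1.1.2 :=
    Primrec.snd.comp (Primrec.fst.comp Primrec.fst)
  have x : Primrec fun y : ((ℕ × List BStr) × Option (BStr × ℕ)) × (BStr × ℕ) => y.2.1 :=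
    Primrec.fst.comp Primrec.snd
  have k : Primrec fun y : ((ℕ × List BStr) × Option (BStr × ℕ)) × (BStr × ℕ) => y.2.2 :=
    Primrec.snd.comp Primrec.snd
  exact Primrec.cond (Primrec.nat_le.decide.comp k B)
    (Primrec.cond (Primrec.nat_lt.decide.comp (Primrec.list_idxOf.comp x L)
      (Primrec.list_length.comp L)) L (Primrec.list_cons.comp x L)) L

/-- Uncurried form of `step`. -/
def stepU (x : (ℕ × List BStr) × Option (BStr × ℕ)) : List BStr := step x.1.1 x.1.2 x.2

theorem stepU_primrec : Primrec stepU := step_primrec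

/-- The strings that appear with bound at most `B` before time `t`. -/
def seen (e : ℕ → Option (BStr × ℕ)) (B t : ℕ) : List BStr :=
  Nat.rec (motive := fun _ => List BStr) [] (fun s IH => step B IH (e s)) t

theorem seen_succ (e : ℕ → Option (BStr × ℕ)) (B t : ℕ) :
    seen e B (t + 1) = step B (seen e B t) (e t) := rfl

theorem seen_computable {e : ℕ → Option (BStr × ℕ)} (he : Computable e) :
    Computable₂ (seen e) := by
  have hh : Computable₂ fun (x : ℕ × ℕ) (y : ℕ × List BStr) => step x.1 y.2 (e y.1) := by
    have h1 : Computable fun z : (ℕ × ℕ) × ℕ × List BStr => ((z.1.1, z.2.2), e z.2.1) :=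
      ((Computable.fst.comp Computable.fst).pair (Computable.snd.comp Computable.snd)).pair
        (he.comp (Computable.fst.comp Computable.snd))
    have h2 : Computable stepU := Primrec.to_comp stepU_primrec
    have h3 : Computable fun z : (ℕ × ℕ) × ℕ × List BStr => stepU ((z.1.1, z.2.2), e z.2.1) :=
      h2.comp h1
    exact h3
  exact Computable.nat_rec (f := fun x : ℕ × ℕ => x.2) (g := fun _ => ([] : List BStr))
    Computable.snd (Computable.const _) hh

theorem mem_step (B : ℕ) (L : List BStr) (o : Option (BStr × ℕ)) (x : BStr) :
    x ∈ step B L o ↔ x ∈ L ∨ ∃ k ≤ B, o = some (x, k) := by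
  rcases o with _ | ⟨y, k⟩
  · simp [step]
  · by_cases hk : k ≤ B
    · by_cases hy : y ∈ L
      · simp only [step, hk, List.idxOf_lt_length_iff, hy, decide_true, cond_true]
        constructor
        · exact Or.inl
        · rintro (h | ⟨k', -, h⟩)
          · exact h
          · simp only [Option.some.injEq, Prod.mk.injEq] at h
            exact h.1 ▸ hy
      · simp only [step, hk, List.idxOf_lt_length_iff, hy, decide_true, decide_false, cond_true,
          cond_false, List.mem_cons, Option.some.injEq, Prod.mk.injEq]
        constructor
        · rintro (h | h)
          · exact Or.inr ⟨k, hk, h.symm, rfl⟩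
          · exact Or.inl h
        · rintro (h | ⟨k', -, h, -⟩)
          · exact Or.inr h
          · exact Or.inl h.symm
    · simp only [step, hk, decide_false, cond_false, Option.some.injEq, Prod.mk.injEq]
      constructor
      · exact Or.inl
      · rintro (h | ⟨k', hk', -, h⟩)
        · exact h
        · omega

theorem nodup_step (B : ℕ) (L : List BStr) (o : Option (BStr × ℕ)) (h : L.Nodup) :
    (step B L o).Nodup := by
  rcases o with _ | ⟨y, k⟩
  · exact h
  · by_cases hk : k ≤ B <;> by_cases hy : y ∈ L <;>
      simp [step, hk, List.idxOf_lt_length_iff, hy, h]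

theorem mem_seen (e : ℕ → Option (BStr × ℕ)) (B t : ℕ) (x : BStr) :
    x ∈ seen e B t ↔ ∃ s < t, ∃ k ≤ B, e s = some (x, k) := by
  induction t with
  | zero => simp [seen]
  | succ t ih =>
    rw [seen_succ, mem_step, ih]
    constructor
    · rintro (⟨s, hs, h⟩ | h)
      · exact ⟨s, by omega, h⟩
      · exact ⟨t, by omega, h⟩
    · rintro ⟨s, hs, h⟩
      rcases Nat.lt_succ_iff_lt_or_eq.1 hs with h' | rfl
      · exact Or.inl ⟨s, h', h⟩
      · exact Or.inr h

theorem nodup_seen (e : ℕ → Option (BStr × ℕ)) (B t : ℕ) : (seen e B t).Nodup := by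
  induction t with
  | zero => simp [seen]
  | succ t ih => exact nodup_step _ _ _ ih

theorem length_seen (e : ℕ → Option (BStr × ℕ)) (B t : ℕ) :
    (seen e B t).length = {x | x ∈ seen e B t}.ncard := by
  have : {x | x ∈ seen e B t} = ((seen e B t).toFinset : Set BStr) := by ext; simp
  rw [this, Set.ncard_coe_finset, List.toFinset_card_of_nodup (nodup_seen e B t)]

theorem finite_seen (e : ℕ → Option (BStr × ℕ)) (B t : ℕ) : {x | x ∈ seen e B t}.Finite := by
  have : {x | x ∈ seen e B t} = ((seen e B t).toFinset : Set BStr) := by ext; simp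
  rw [this]; exact Finset.finite_toSet _

/-- The threshold test of the decompressor. -/
def test (e : ℕ → Option (BStr × ℕ)) (p : BStr) (t : ℕ) : Bool :=
  decide ((dec p).2.2.2 * 2 ^ (2 ^ (dec p).2.1 + 1 - (dec p).2.2.1)
    ≤ (seen e (2 ^ (dec p).2.1) t).length)

/-- The output of the decompressor: a string not seen with bound `n` before time `t`. -/
def out (e : ℕ → Option (BStr × ℕ)) (p : BStr) (t : ℕ) : BStr :=
  (seen e (dec p).2.1 t).flatten ++ [true]

def decomp (e : ℕ → Option (BStr × ℕ)) : BStr →. BStr := fun p =>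
  (Nat.rfind (fun t => Part.some (test e p t))).map (out e p)

theorem pow_primrec : Primrec₂ ((· ^ ·) : ℕ → ℕ → ℕ) :=
  Primrec₂.unpaired'.1 Nat.Primrec.pow

theorem decomp_partrec {e : ℕ → Option (BStr × ℕ)} (he : Computable e) :
    Partrec (decomp e) := by
  have d : Computable fun x : BStr × ℕ => dec x.1 := dec_primrec.to_comp.comp Computable.fst
  have n : Computable fun x : BStr × ℕ => (dec x.1).2.1 :=
    Computable.fst.comp (Computable.snd.comp d)
  have l : Computable fun x : BStr × ℕ => (dec x.1).2.2.1 :=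
    Computable.fst.comp (Computable.snd.comp (Computable.snd.comp d))
  have m : Computable fun x : BStr × ℕ => (dec x.1).2.2.2 :=
    Computable.snd.comp (Computable.snd.comp (Computable.snd.comp d))
  have N : Computable fun x : BStr × ℕ => 2 ^ (dec x.1).2.1 :=
    pow_primrec.to_comp.comp (Computable.const 2) n
  have ht : Computable₂ (test e) := by
    refine Primrec.nat_le.decide.to_comp.comp
      (Primrec.nat_mul.to_comp.comp m (pow_primrec.to_comp.comp (Computable.const 2)
        (Primrec.nat_sub.to_comp.comp (Primrec.nat_add.to_comp.comp N (Computable.const 1)) l)))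
      (Computable.list_length.comp ((seen_computable he).comp N Computable.snd))
  have ho : Computable₂ (out e) :=
    Computable.list_append.comp
      (Primrec.list_flatten.to_comp.comp ((seen_computable he).comp n Computable.snd))
      (Computable.const _)
  exact Partrec.map (Partrec.rfind ht.partrec₂) ho

theorem out_not_mem (e : ℕ → Option (BStr × ℕ)) (p : BStr) (t : ℕ) :
    out e p t ∉ seen e (dec p).2.1 t := by
  intro h
  have := (List.sublist_flatten_of_mem h).length_le
  simp [out] at this

/-- All strings of length at most `n`. -/
def allStr : ℕ → Finset BStr
  | 0 => {[]}
  | n + 1 => insert [] ((allStr n).image (List.cons true) ∪ (allStr n).image (List.cons false))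

theorem mem_allStr (n : ℕ) (x : BStr) (h : x.length ≤ n) : x ∈ allStr n := by
  induction n generalizing x with
  | zero => simp at h; simp [allStr, h]
  | succ n ih =>
    rcases x with _ | ⟨b, x⟩
    · simp [allStr]
    · have := ih x (by simpa using h)
      cases b <;> simp [allStr, this]

theorem card_allStr (n : ℕ) : (allStr n).card + 1 ≤ 2 ^ (n + 1) := by
  induction n with
  | zero => simp [allStr]
  | succ n ih =>
    have h1 := Finset.card_insert_le ([] : BStr)
      ((allStr n).image (List.cons true) ∪ (allStr n).image (List.cons false))
    have h2 := Finset.card_union_le ((allStr n).image (List.cons true))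
      ((allStr n).image (List.cons false))
    have h3 := Finset.card_image_le (s := allStr n) (f := List.cons true)
    have h4 := Finset.card_image_le (s := allStr n) (f := List.cons false)
    rw [pow_succ]
    simp only [allStr]
    omega

theorem exists_short (O : OptimalDecompressor) (x : BStr) :
    ∃ p : BStr, p.length = plainC O.V x ∧ x ∈ O.V p := by
  obtain ⟨p, hp⟩ := O.onto x
  exact Nat.sInf_mem (s := {n | ∃ p : BStr, p.length = n ∧ x ∈ O.V p}) ⟨p.length, p, rfl, hp⟩

theorem simple_finite_card (O : OptimalDecompressor) (N : ℕ) :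
    {x | plainC O.V x ≤ N}.Finite ∧ {x | plainC O.V x ≤ N}.ncard < 2 ^ (N + 1) := by
  choose f hf hfm using exists_short O
  have hinj : Function.Injective f := by
    intro x y hxy
    have := hfm y
    rw [← hxy] at this
    exact Part.mem_unique (hfm x) this
  have hsub : Set.image f {x | plainC O.V x ≤ N} ⊆ (allStr N : Set BStr) := by
    rintro _ ⟨x, hx, rfl⟩
    exact mem_allStr _ _ ((hf x).trans_le hx)
  refine ⟨((Finset.finite_toSet _).subset hsub).of_finite_image hinj.injOn, ?_⟩
  have h1 := Set.ncard_le_ncard hsub (Finset.finite_toSet _)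
  rw [Set.ncard_image_of_injective _ hinj, Set.ncard_coe_finset] at h1
  have := card_allStr N
  omega

theorem strFirst_mem (O : OptimalDecompressor) (E : CanonicalEnum O.V) {x : BStr} {n : ℕ}
    (h : plainC O.V x ≤ n) : ∃ k ≤ n, E.e (strFirst E x n) = some (x, k) := by
  obtain ⟨t, ht⟩ := (E.mem_iff x n).2 h
  exact Nat.sInf_mem (s := {t | ∃ k ≤ n, E.e t = some (x, k)}) ⟨t, n, le_rfl, ht⟩

theorem mem_seen_iff (O : OptimalDecompressor) (E : CanonicalEnum O.V) (x : BStr) (n t : ℕ) :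
    x ∈ seen E.e n t ↔ plainC O.V x ≤ n ∧ strFirst E x n < t := by
  rw [mem_seen]
  constructor
  · rintro ⟨s, hs, k, hk, h⟩
    exact ⟨((E.mem_iff x k).1 ⟨s, h⟩).trans hk, lt_of_le_of_lt
      (Nat.sInf_le (s := {t | ∃ k ≤ n, E.e t = some (x, k)}) ⟨k, hk, h⟩) hs⟩
  · rintro ⟨h, ht⟩
    exact ⟨_, ht, strFirst_mem O E h⟩

end TailBound

open TailBound

/-- There is a constant `c₁` (depending only on `V`) such that
for every `n`, `Rest(n, 2^n) ≤ c₁ · 2^{2^n − n}`. -/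
theorem tail_upper_bound_exponential
    (O : OptimalDecompressor) (E : CanonicalEnum O.V) :
    ∃ c₁ : ℕ, ∀ n : ℕ, ∀ w : BStr, IsLastSimple O E n w →
      (RestSet O E n (2 ^ n) w).Finite ∧
      (RestSet O E n (2 ^ n) w).ncard ≤ c₁ * 2 ^ (2 ^ n - n) := by
  obtain ⟨M, hM⟩ := O.optimal (decomp E.e) (decomp_partrec E.computable)
  refine ⟨2 ^ (2 * (M + 1) + 1), fun n w hw => ?_⟩
  set N := 2 ^ n with hN
  have hnN : n < N := Nat.lt_two_pow_self
  obtain ⟨hfin, hcard⟩ := simple_finite_card O N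
  have hsub : RestSet O E n N w ⊆ {x | plainC O.V x ≤ N} := fun x hx => hx.1
  have hRfin := hfin.subset hsub
  refine ⟨hRfin, ?_⟩
  have hRle := Set.ncard_le_ncard hsub hfin
  rw [← pow_add]
  by_cases hn : n < 2 * (M + 1)
  · refine (hRle.trans hcard.le).trans (Nat.pow_le_pow_right (by norm_num) (by omega))
  push Not at hn
  obtain ⟨l, rfl⟩ := Nat.exists_eq_add_of_le hn
  by_contra! hR
  set A := {x | plainC O.V x ≤ N}.ncard with hA
  set R := (RestSet O E (2 * (M + 1) + l) N w).ncard with hRdef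
  set S := 2 ^ (N + 1 - l) with hS
  have hSR : S < R := by
    have : N + 1 - l = 2 * (M + 1) + 1 + (N - (2 * (M + 1) + l)) := by omega
    rw [hS, this]; exact hR
  have hSpos : 0 < S := by positivity
  have hm : A / S < 2 ^ l := by
    rw [Nat.div_lt_iff_lt_mul hSpos, hS, ← pow_add]
    have : l + (N + 1 - l) = N + 1 := by omega
    rw [this]; exact hcard
  obtain ⟨p, hpl, hp⟩ := exists_prog (M + 1) l (A / S) hm
  have htest : ∀ t, test E.e p t = true ↔ A / S * S ≤ (seen E.e N t).length := by
    intro t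
    simp only [test, hp, decide_eq_true_eq]
    exact Iff.rfl
  have hAS : A / S * S ≤ A := Nat.div_mul_le_self A S
  have hAS' : A < A / S * S + S := by
    have := Nat.lt_div_mul_add hSpos (a := A)
    exact this
  -- the search terminates
  obtain ⟨t₀, ht₀⟩ : ∃ t, test E.e p t = true := by
    obtain ⟨b, hb⟩ := (hfin.image fun x => strFirst E x N).bddAbove
    refine ⟨b + 1, (htest _).2 (hAS.trans ?_)⟩
    rw [length_seen]
    refine Set.ncard_le_ncard ?_ (finite_seen _ _ _)
    intro x hx
    exact (mem_seen_iff O E x N _).2 ⟨hx, Nat.lt_succ_of_le (hb ⟨x, hx, rfl⟩)⟩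
  have hdom : (Nat.rfind (fun t => Part.some (test E.e p t))).Dom := by
    exact Nat.rfind_dom.2 ⟨t₀, Part.mem_some_iff.2 ht₀.symm, fun _ => trivial⟩
  obtain ⟨T, hT⟩ := Part.dom_iff_mem.1 hdom
  have hTt : test E.e p T = true := by
    exact (Part.mem_some_iff.1 (Nat.rfind_spec hT)).symm
  -- the search stops after the appearance of `w`
  have hlate : strFirst E w (2 * (M + 1) + l) + 1 < T := by
    by_contra! hle
    have h1 := (htest T).1 hTt
    have hdisj : {x | x ∈ seen E.e N T} ⊆
        {x | plainC O.V x ≤ N} \ RestSet O E (2 * (M + 1) + l) N w := by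
      intro x hx
      obtain ⟨h2, h3⟩ := (mem_seen_iff O E x N T).1 hx
      refine ⟨h2, fun h4 => ?_⟩
      have := h4.2
      omega
    have h2 := Set.ncard_le_ncard hdisj (hfin.subset Set.sdiff_subset)
    rw [Set.ncard_sdiff hsub hRfin, ← length_seen] at h2
    omega
  -- the output is simple
  have hmem : out E.e p T ∈ decomp E.e p := Part.mem_map _ hT
  have hCD : plainC (decomp E.e) (out E.e p T) ≤ p.length := Nat.sInf_le ⟨p, rfl, hmem⟩
  have hCV := hM _ ⟨p, hmem⟩
  have hsimple : plainC O.V (out E.e p T) ≤ 2 * (M + 1) + l := by omega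
  have hbefore := hw.2 _ hsimple
  refine out_not_mem E.e p T ?_
  rw [hp]
  exact (mem_seen_iff O E _ _ _).2 ⟨hsimple, by dsimp only; omega⟩
end

section
/- There exists a constant c such that for every string x and every integer q: if K(x | q) ≤ q then C_V(x) ≤ q + c. -/
open scoped Classical ENNReal

theorem primrec_natStr : Primrec natStr := by
  have h : Primrec₂ (fun (_ : Unit) (n : ℕ) => natStr n) := by
    refine Primrec.nat_strong_rec (fun (_ : Unit) (n : ℕ) => natStr n)
      (g := fun _ l => if l.length = 0 then some [] else
        (l[(Nat.div2 l.length)]?).map (fun b => Nat.bodd l.length :: b)) ?_ ?_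
    · have hl : Primrec (fun p : Unit × List BStr => p.2.length) :=
        Primrec.list_length.comp Primrec.snd
      refine Primrec.ite (Primrec.eq.comp hl (Primrec.const 0)) (Primrec.const _) ?_
      refine Primrec.option_map
        (Primrec.list_getElem?.comp Primrec.snd (Primrec.nat_div2.comp hl)) ?_
      exact Primrec.list_cons.comp (Primrec.nat_bodd.comp (hl.comp Primrec.fst)) Primrec.snd
    · intro _ n
      rcases Nat.eq_zero_or_pos n with rfl | hn
      · simp [natStr]
      · have h2 : n.div2 < n := by rw [Nat.div2_val]; omega
        have hb : natStr n = n.bodd :: natStr n.div2 := by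
          unfold natStr
          conv_lhs => rw [← Nat.bit_bodd_div2 n]
          apply Nat.bits_append_bit
          intro h0
          have := Nat.bit_bodd_div2 n
          rw [h0] at this
          cases hbb : n.bodd
          · rw [hbb] at this; simp at this; omega
          · rfl
        simp [hn.ne', h2, hb]
  exact h.comp (Primrec.const ()) Primrec.id

/-- Drop the padding `0…01` in front of a program. -/
def unpad : BStr → BStr
  | [] => []
  | b :: l => if b = true then l else unpad l

theorem primrec_unpad : Primrec unpad := by
  have h : Primrec (fun w : BStr => (List.rec [] (fun b l ih => if b = true then l else ih) w : BStr)) := by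
    refine Primrec.list_rec (f := fun w : BStr => w) (g := fun _ => ([] : BStr))
      (h := fun _ p => if p.1 = true then p.2.1 else p.2.2) Primrec.id (Primrec.const _) ?_
    have h2 : Primrec (fun p : BStr × Bool × BStr × BStr => p.2) := Primrec.snd
    exact Primrec.ite (Primrec.eq.comp (Primrec.fst.comp h2) (Primrec.const true))
      (Primrec.fst.comp (Primrec.snd.comp h2)) (Primrec.snd.comp (Primrec.snd.comp h2))
  refine h.of_eq fun w => ?_
  induction w with
  | nil => rfl
  | cons b l ih => simp only [unpad, ← ih]

theorem unpad_pad (k : ℕ) (p : BStr) : unpad (List.replicate k false ++ true :: p) = p := by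
  induction k with
  | zero => simp [unpad]
  | succ k ih => simpa [List.replicate_succ, unpad] using ih

/-- There is a constant `c` such that for every string `x` and
integer `q`: if `K(x | q) ≤ q` then `C_V(x) ≤ q + c`. -/
theorem prefix_le_imp_plain_le
    (O : OptimalDecompressor) (U : UniversalPrefixDecompressor) :
    ∃ c : ℕ, ∀ x : BStr, ∀ q : ℕ, K U x (natStr q) ≤ q →
      plainC O.V x ≤ q + c := by
  have hD : Partrec (fun w : BStr => U.D (unpad w) (natStr (w.length - 1))) :=
    U.partrec.comp primrec_unpad.to_comp
      (primrec_natStr.comp (Primrec.nat_sub.comp Primrec.list_length (Primrec.const 1))).to_comp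
  obtain ⟨M, hM⟩ := O.optimal _ hD
  refine ⟨M + 1, fun x q hK => ?_⟩
  obtain ⟨p, hp, hx⟩ : K U x (natStr q) ∈
      {n | ∃ p : BStr, p.length = n ∧ x ∈ U.D p (natStr q)} := by
    apply Nat.sInf_mem
    obtain ⟨p, hp⟩ := U.onto x (natStr q)
    exact ⟨_, p, rfl, hp⟩
  have hlen : (List.replicate (q - p.length) false ++ true :: p).length = q + 1 := by
    simp; omega
  have hw : x ∈ U.D (unpad (List.replicate (q - p.length) false ++ true :: p))
      (natStr ((List.replicate (q - p.length) false ++ true :: p).length - 1)) := by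
    rw [unpad_pad, hlen]; exact hx
  have h1 := hM x ⟨_, hw⟩
  have h2 : plainC (fun w : BStr => U.D (unpad w) (natStr (w.length - 1))) x ≤ q + 1 :=
    Nat.sInf_le ⟨_, hlen, hw⟩
  omega
end

section
/- There exists a constant c such that for every integer t, every integer δ ≥ 0, and every string (or tuple) y with |y| < 2^t/2 − c: m(y | t) ≥ (1/c) · |T_t^δ(y)| · 2^{−2^t − cδ}, where T_t^δ(y) = {s : C_V(y, s) ≤ 2^t + δ}. -/
open scoped Classical ENNReal

/-- A lower semicomputable conditional semimeasure: a nonnegative function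
`μ(x | y)` with `Σ_x μ(x | y) ≤ 1` for each `y`, approximable from below by a
computable monotone sequence of dyadic rationals. -/
structure CondSemimeasure where
  μ : BStr → BStr → ℝ≥0∞
  approx : ℕ → BStr → BStr → ℕ
  approx_computable : Computable fun p : ℕ × BStr × BStr => approx p.1 p.2.1 p.2.2
  approx_mono : ∀ x y : BStr, Monotone fun t => (approx t x y : ℝ≥0∞) / 2 ^ t
  approx_sup : ∀ x y : BStr, (⨆ t, (approx t x y : ℝ≥0∞) / 2 ^ t) = μ x y
  sum_le_one : ∀ y : BStr, (∑' x : BStr, μ x y) ≤ 1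

/-- A universal conditional semimeasure `m(x | y)`: a lower semicomputable
conditional semimeasure that multiplicatively dominates every lower
semicomputable conditional semimeasure. -/
structure UniversalCondSemimeasure extends CondSemimeasure where
  dominates : ∀ ν : CondSemimeasure, ∃ c : ℕ, 0 < c ∧
    ∀ x y : BStr, ν.μ x y ≤ (c : ℝ≥0∞) * μ x y

namespace RelExt
open Encodable Nat.Partrec

/-- decoding of `natStr` -/
def dec (z : BStr) : ℕ := z.foldr (fun b s => 2 * s + encode b) 0

lemma dec_natStr (n : ℕ) : dec (natStr n) = n := by
  unfold natStr
  induction n using Nat.binaryRec' with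
  | zero => simp [dec]
  | bit b n h ih =>
    rw [Nat.bits_append_bit _ _ h]
    unfold dec at ih ⊢
    rw [List.foldr_cons, ih]
    cases b <;> simp [Nat.bit]

lemma dec_primrec : Primrec dec := by
  have h : Primrec₂ (fun (_ : BStr) (q : Bool × ℕ) => 2 * q.2 + encode q.1) :=
    (Primrec.nat_add.comp (Primrec.nat_mul.comp (Primrec.const 2) (Primrec.snd.comp Primrec.snd))
      (Primrec.encode.comp (Primrec.fst.comp Primrec.snd))).to₂
  exact Primrec.list_foldr Primrec.id (Primrec.const 0) h

lemma pow_primrec : Primrec₂ (fun a b : ℕ => a ^ b) :=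
  Primrec₂.unpaired'.1 Nat.Primrec.pow

/-- first component of a coded pair -/
def fstOf (u : BStr) : BStr := ((decode (α := BStr × BStr) (dec u)).getD ([], [])).1

lemma fstOf_pair (y s : BStr) : fstOf (pairStr y s) = y := by
  unfold fstOf pairStr
  rw [dec_natStr, encodek]; rfl

lemma fstOf_primrec : Primrec fstOf :=
  Primrec.fst.comp (Primrec.option_getD.comp (Primrec.decode.comp dec_primrec) (Primrec.const _))

/-- the program with code `i` -/
def pr (i : ℕ) : BStr := (decode (α := BStr) i).getD []

lemma pr_encode (p : BStr) : pr (encode p) = p := by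
  unfold pr; rw [encodek]; rfl

lemma pr_primrec : Primrec pr :=
  Primrec.option_getD.comp Primrec.decode (Primrec.const _)

/-- exponent of the weight -/
def ex (z p : BStr) : ℕ := 2 ^ dec z + 2 * (p.length - 2 ^ dec z) + 2

lemma ex_primrec : Primrec₂ ex := by
  have h1 : Primrec (fun a : BStr × BStr => 2 ^ dec a.1) :=
    pow_primrec.comp (Primrec.const 2) (dec_primrec.comp Primrec.fst)
  exact Primrec.nat_add.comp (Primrec.nat_add.comp h1 (Primrec.nat_mul.comp (Primrec.const 2)
    (Primrec.nat_sub.comp (Primrec.list_length.comp Primrec.snd) h1))) (Primrec.const 2)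

/-- condition at stage `τ` -/
def cnd (c : Code) (τ : ℕ) (x z : BStr) (i : ℕ) : Prop :=
  (Code.evaln τ c i = some (encode x) ∧ encode (pr i) = i) ∧ ex z (pr i) ≤ τ

instance cnd_dec (c : Code) (τ : ℕ) (x z : BStr) (i : ℕ) : Decidable (cnd c τ x z i) := by
  unfold cnd; infer_instance

/-- stage `τ` summand -/
def trm (c : Code) (τ : ℕ) (x z : BStr) (i : ℕ) : ℕ :=
  if cnd c τ x z i then 2 ^ (τ - ex z (pr i)) else 0

lemma trm_primrec (c : Code) :
    Primrec (fun a : (ℕ × BStr × BStr) × ℕ => trm c a.1.1 a.1.2.1 a.1.2.2 a.2) := by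
  have hτ : Primrec (fun a : (ℕ × BStr × BStr) × ℕ => a.1.1) := Primrec.fst.comp Primrec.fst
  have hx : Primrec (fun a : (ℕ × BStr × BStr) × ℕ => a.1.2.1) :=
    Primrec.fst.comp (Primrec.snd.comp Primrec.fst)
  have hz : Primrec (fun a : (ℕ × BStr × BStr) × ℕ => a.1.2.2) :=
    Primrec.snd.comp (Primrec.snd.comp Primrec.fst)
  have hi : Primrec (fun a : (ℕ × BStr × BStr) × ℕ => a.2) := Primrec.snd
  have hp := pr_primrec.comp hi
  have he := ex_primrec.comp hz hp
  have hev : Primrec (fun a : (ℕ × BStr × BStr) × ℕ => Code.evaln a.1.1 c a.2) :=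
    Code.primrec_evaln.comp (Primrec.pair (Primrec.pair hτ (Primrec.const c)) hi)
  have hc : PrimrecPred (fun a : (ℕ × BStr × BStr) × ℕ => cnd c a.1.1 a.1.2.1 a.1.2.2 a.2) :=
    ((Primrec.eq.comp hev (Primrec.option_some.comp (Primrec.encode.comp hx))).and
      (Primrec.eq.comp (Primrec.encode.comp hp) hi)).and (Primrec.nat_le.comp he hτ)
  exact Primrec.ite hc (pow_primrec.comp (Primrec.const 2) (Primrec.nat_sub.comp hτ he))
    (Primrec.const 0)

/-- stage `τ` approximation -/
def apx (c : Code) (τ : ℕ) (x z : BStr) : ℕ := ∑ i ∈ Finset.range τ, trm c τ x z i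

lemma apx_primrec (c : Code) :
    Primrec (fun a : ℕ × BStr × BStr => apx c a.1 a.2.1 a.2.2) := by
  have h : Primrec₂ (fun (a : ℕ × BStr × BStr) (q : ℕ × ℕ) =>
      q.2 + trm c a.1 a.2.1 a.2.2 q.1) :=
    Primrec.nat_add.comp (Primrec.snd.comp Primrec.snd)
      ((trm_primrec c).comp (Primrec.pair Primrec.fst (Primrec.fst.comp Primrec.snd)))
  refine (Primrec.nat_rec' (f := fun a : ℕ × BStr × BStr => a.1) Primrec.fst
    (Primrec.const 0) h).of_eq ?_
  intro a
  unfold apx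
  generalize hn : a.1 = n
  rw [← hn]
  have : ∀ n : ℕ, Nat.rec (motive := fun _ => ℕ) 0
      (fun n IH => IH + trm c a.1 a.2.1 a.2.2 n) n
      = ∑ i ∈ Finset.range n, trm c a.1 a.2.1 a.2.2 i := by
    intro n
    induction n with
    | zero => rfl
    | succ k ih => rw [Finset.sum_range_succ, ← ih]
  exact this a.1

/-- real-valued stage summand -/
noncomputable def rtrm (c : Code) (τ : ℕ) (x z : BStr) (i : ℕ) : ℝ≥0∞ :=
  if cnd c τ x z i then (2⁻¹ : ℝ≥0∞) ^ ex z (pr i) else 0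

/-- limit summand -/
noncomputable def ltrm (c : Code) (x z : BStr) (i : ℕ) : ℝ≥0∞ :=
  if encode x ∈ Code.eval c i ∧ encode (pr i) = i then (2⁻¹ : ℝ≥0∞) ^ ex z (pr i) else 0

lemma trm_div (c : Code) (τ : ℕ) (x z : BStr) (i : ℕ) :
    (trm c τ x z i : ℝ≥0∞) / 2 ^ τ = rtrm c τ x z i := by
  unfold trm rtrm
  split_ifs with h
  · have h2 := h.2
    obtain ⟨d, hd⟩ := Nat.exists_eq_add_of_le h2
    rw [hd, Nat.add_sub_cancel_left]
    push_cast
    rw [pow_add, ← ENNReal.inv_pow, ENNReal.div_eq_inv_mul,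
      ENNReal.mul_inv (Or.inl (by simp)) (Or.inl (by simp)), mul_assoc,
      ENNReal.inv_mul_cancel (by simp) (by simp), mul_one]
  · simp

lemma apx_div (c : Code) (τ : ℕ) (x z : BStr) :
    (apx c τ x z : ℝ≥0∞) / 2 ^ τ = ∑ i ∈ Finset.range τ, rtrm c τ x z i := by
  unfold apx
  push_cast
  rw [ENNReal.div_eq_inv_mul, Finset.mul_sum]
  refine Finset.sum_congr rfl fun i _ => ?_
  rw [← ENNReal.div_eq_inv_mul, trm_div]

lemma rtrm_mono (c : Code) (x z : BStr) (i : ℕ) : Monotone fun τ => rtrm c τ x z i := by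
  intro a b hab
  simp only [rtrm]
  split_ifs with h1 h2
  · exact le_rfl
  · exact absurd ⟨⟨Code.evaln_mono hab h1.1.1, h1.1.2⟩, h1.2.trans hab⟩ h2
  · exact zero_le
  · exact le_rfl

lemma rtrm_le (c : Code) (τ : ℕ) (x z : BStr) (i : ℕ) : rtrm c τ x z i ≤ ltrm c x z i := by
  unfold rtrm ltrm
  split_ifs with h1 h2
  · exact le_rfl
  · exact absurd ⟨Code.evaln_sound h1.1.1, h1.1.2⟩ h2
  · exact zero_le
  · exact le_rfl

lemma rtrm_ev (c : Code) (x z : BStr) (i : ℕ) :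
    ∃ k, ∀ τ, k ≤ τ → ltrm c x z i ≤ rtrm c τ x z i := by
  by_cases h : encode x ∈ Code.eval c i ∧ encode (pr i) = i
  · obtain ⟨k, hk⟩ := Code.evaln_complete.1 h.1
    refine ⟨k + ex z (pr i), fun τ hτ => ?_⟩
    have : cnd c τ x z i := ⟨⟨Code.evaln_mono (by omega) hk, h.2⟩, by omega⟩
    simp only [ltrm, rtrm, if_pos h, if_pos this, le_refl]
  · exact ⟨0, fun τ _ => by simp only [ltrm, if_neg h, zero_le]⟩

lemma apx_mono (c : Code) (x z : BStr) :
    Monotone fun τ => (apx c τ x z : ℝ≥0∞) / 2 ^ τ := by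
  intro a b hab
  simp only [apx_div]
  calc _ ≤ ∑ i ∈ Finset.range a, rtrm c b x z i :=
        Finset.sum_le_sum fun i _ => rtrm_mono c x z i hab
    _ ≤ _ := Finset.sum_le_sum_of_subset (Finset.range_mono hab)

lemma apx_sup (c : Code) (x z : BStr) :
    (⨆ τ, (apx c τ x z : ℝ≥0∞) / 2 ^ τ) = ∑' i, ltrm c x z i := by
  apply le_antisymm
  · refine iSup_le fun τ => ?_
    rw [apx_div]
    exact (Finset.sum_le_sum fun i _ => rtrm_le c τ x z i).trans (ENNReal.sum_le_tsum _)
  · rw [ENNReal.tsum_eq_iSup_nat]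
    refine iSup_le fun n => ?_
    choose k hk using rtrm_ev c x z
    refine le_trans ?_ (le_iSup _ (n + ∑ i ∈ Finset.range n, k i))
    rw [apx_div]
    calc _ ≤ ∑ i ∈ Finset.range n, rtrm c (n + ∑ i ∈ Finset.range n, k i) x z i := by
          refine Finset.sum_le_sum fun i hi => hk i _ ?_
          exact (Finset.single_le_sum (f := k) (fun _ _ => Nat.zero_le _) hi).trans
            (Nat.le_add_left _ _)
      _ ≤ _ := Finset.sum_le_sum_of_subset (Finset.range_mono (Nat.le_add_right _ _))

lemma tsum_len (f : ℕ → ℝ≥0∞) : ∑' p : BStr, f p.length = ∑' n, 2 ^ n * f n := by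
  rw [← (Equiv.sigmaFiberEquiv (List.length : BStr → ℕ)).tsum_eq, ENNReal.tsum_sigma']
  refine tsum_congr fun n => ?_
  have : ∀ b : {p : BStr // p.length = n},
      f ((Equiv.sigmaFiberEquiv (List.length : BStr → ℕ)) ⟨n, b⟩).length = f n := by
    rintro ⟨b, rfl⟩; rfl
  simp only [this]
  have hc : Fintype.card (List.Vector Bool n) = 2 ^ n := by simp
  change ∑' _ : List.Vector Bool n, f n = _
  rw [tsum_fintype, Finset.sum_const, Finset.card_univ, hc]
  simp

lemma half_two (n d : ℕ) : (2 : ℝ≥0∞) ^ n * 2⁻¹ ^ (n + d) = 2⁻¹ ^ d := by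
  rw [pow_add, ← mul_assoc, ← mul_pow, ENNReal.mul_inv_cancel (by simp) (by simp), one_pow, one_mul]

lemma kraft (z : BStr) : ∑' p : BStr, (2⁻¹ : ℝ≥0∞) ^ ex z p ≤ 1 := by
  generalize hN : 2 ^ dec z = N
  have : ∀ p, ex z p = N + 2 * (p.length - N) + 2 := by intro p; rw [ex, hN]
  simp only [this]
  rw [tsum_len (fun n => (2⁻¹ : ℝ≥0∞) ^ (N + 2 * (n - N) + 2)),
    ← Summable.sum_add_tsum_nat_add' (k := N) ENNReal.summable]
  have h1 : ∑ n ∈ Finset.range N, (2 : ℝ≥0∞) ^ n * 2⁻¹ ^ (N + 2 * (n - N) + 2) ≤ 2⁻¹ := by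
    calc _ = ∑ n ∈ Finset.range N, (2 : ℝ≥0∞) ^ n * 2⁻¹ ^ (N + 2) := by
          refine Finset.sum_congr rfl fun n hn => ?_
          have := Finset.mem_range.1 hn
          rw [Nat.sub_eq_zero_of_le this.le, mul_zero, add_zero]
      _ = (∑ n ∈ Finset.range N, (2 : ℝ≥0∞) ^ n) * 2⁻¹ ^ (N + 2) := by rw [Finset.sum_mul]
      _ ≤ 2 ^ N * 2⁻¹ ^ (N + 2) := by
          gcongr
          have := (Nat.geomSum_lt (m := 2) (n := N) (s := Finset.range N) le_rfl
            (fun k hk => Finset.mem_range.1 hk)).le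
          exact_mod_cast this
      _ = 2⁻¹ ^ 2 := half_two _ _
      _ ≤ 2⁻¹ ^ 1 := pow_le_pow_of_le_one (zero_le) (by simp) (by norm_num)
      _ = _ := pow_one _
  have h2 : ∑' n, (2 : ℝ≥0∞) ^ (n + N) * 2⁻¹ ^ (N + 2 * (n + N - N) + 2) ≤ 2⁻¹ := by
    refine le_of_eq ?_
    calc _ = ∑' n : ℕ, (2⁻¹ : ℝ≥0∞) ^ 2 * 2⁻¹ ^ n := by
          refine tsum_congr fun n => ?_
          rw [Nat.add_sub_cancel, show N + 2 * n + 2 = (n + N) + (2 + n) by ring, half_two, pow_add]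
      _ = 2⁻¹ := by
          rw [ENNReal.tsum_mul_left, ENNReal.tsum_geometric, ENNReal.one_sub_inv_two, inv_inv, pow_two,
            mul_assoc, ENNReal.inv_mul_cancel (by simp) (by simp), mul_one]
  exact (add_le_add h1 h2).trans_eq ENNReal.inv_two_add_inv_two

lemma ltrm_sum (c : Code) (z : BStr) : ∑' x, ∑' i, ltrm c x z i ≤ 1 := by
  rw [ENNReal.tsum_comm]
  have h1 : ∀ i, ∑' x, ltrm c x z i ≤
      if encode (pr i) = i then (2⁻¹ : ℝ≥0∞) ^ ex z (pr i) else 0 := by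
    intro i
    by_cases h : ∃ x : BStr, encode x ∈ Code.eval c i
    · obtain ⟨x, hx⟩ := h
      rw [tsum_eq_single x]
      · unfold ltrm
        by_cases h : encode (pr i) = i <;> simp [h, hx]
      · intro b hb
        rw [ltrm, if_neg]
        rintro ⟨hb', -⟩
        exact hb (encode_injective (Part.mem_unique hb' hx))
    · push Not at h
      have : ∀ x, ltrm c x z i = 0 := fun x => by rw [ltrm, if_neg]; exact fun hh => h x hh.1
      simp [this]
  refine (ENNReal.tsum_le_tsum h1).trans ?_
  refine le_trans (le_of_eq ?_) (kraft z)
  symm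
  have h2 : ∀ p : BStr, (2⁻¹ : ℝ≥0∞) ^ ex z p = (fun i => if encode (pr i) = i then
      (2⁻¹ : ℝ≥0∞) ^ ex z (pr i) else 0) (encode p) := by
    intro p
    simp only [pr_encode, if_true]
  rw [tsum_congr h2]
  refine Function.Injective.tsum_eq (f := fun i => if encode (pr i) = i then
      (2⁻¹ : ℝ≥0∞) ^ ex z (pr i) else 0) (encode_injective (α := BStr)) ?_
  intro i hi
  by_contra hcon
  apply hi
  simp only
  rw [if_neg]
  intro h
  exact hcon ⟨_, h⟩

/-- the semimeasure -/
noncomputable def nu (c : Code) : CondSemimeasure where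
  μ x z := ∑' i, ltrm c x z i
  approx := apx c
  approx_computable := (apx_primrec c).to_comp
  approx_mono := apx_mono c
  approx_sup := apx_sup c
  sum_le_one := ltrm_sum c

lemma exists_nu (O : OptimalDecompressor) : ∃ c : Code, ∀ p y s : BStr,
    pairStr y s ∈ O.V p → encode y ∈ Code.eval c (encode p) := by
  have h : Partrec (fun p => (O.V p).map fstOf) :=
    O.partrec.map (fstOf_primrec.to_comp.comp Computable.snd).to₂
  obtain ⟨c, hc⟩ := Code.exists_code.1 h
  refine ⟨c, fun p y s hs => ?_⟩
  rw [hc]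
  simp only [encodek, Part.coe_some, Part.bind_some, Part.mem_map_iff]
  exact ⟨y, ⟨_, hs, fstOf_pair y s⟩, rfl⟩

lemma pairStr_inj (y s s' : BStr) (h : pairStr y s = pairStr y s') : s = s' := by
  have := congrArg dec h
  unfold pairStr at this
  rw [dec_natStr, dec_natStr] at this
  exact (Prod.ext_iff.1 (encode_injective this)).2

lemma lower (O : OptimalDecompressor) (c : Code)
    (hc : ∀ p y s : BStr, pairStr y s ∈ O.V p → encode y ∈ Code.eval c (encode p))
    (t δ : ℕ) (y : BStr) :
    ((TsetR O t δ y).ncard : ℝ≥0∞) * 2⁻¹ ^ (2 ^ t + 2 * δ + 2) ≤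
      ∑' i, ltrm c y (natStr t) i := by
  by_cases hf : (TsetR O t δ y).Finite
  swap
  · rw [Set.Infinite.ncard hf]; simp
  have hex : ∀ s : BStr, ∃ p : BStr, pairStr y s ∈ O.V p ∧
      p.length = plainC O.V (pairStr y s) := by
    intro s
    obtain ⟨p, hp⟩ := O.onto (pairStr y s)
    obtain ⟨q, hq, hq'⟩ := Nat.sInf_mem
      (s := {n | ∃ p : BStr, p.length = n ∧ pairStr y s ∈ O.V p}) ⟨_, p, rfl, hp⟩
    exact ⟨q, hq', hq⟩
  choose P hP hPl using hex
  have hinj : Function.Injective fun s => encode (P s) := by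
    intro s s' h
    have h' := encode_injective h
    refine pairStr_inj y s s' (Part.mem_unique (hP s) ?_)
    rw [h']; exact hP s'
  rw [Set.ncard_eq_toFinset_card _ hf]
  calc _ = ∑ s ∈ hf.toFinset, (2⁻¹ : ℝ≥0∞) ^ (2 ^ t + 2 * δ + 2) := by
        rw [Finset.sum_const, nsmul_eq_mul]
    _ ≤ ∑ s ∈ hf.toFinset, ltrm c y (natStr t) (encode (P s)) := by
        refine Finset.sum_le_sum fun s hs => ?_
        have hs' : plainC O.V (pairStr y s) ≤ 2 ^ t + δ := (Set.Finite.mem_toFinset hf).1 hs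
        rw [ltrm, if_pos ⟨hc _ _ _ (hP s), by rw [pr_encode]⟩, pr_encode]
        refine pow_le_pow_of_le_one (zero_le) (by simp) ?_
        rw [ex, dec_natStr, hPl]
        omega
    _ ≤ ∑' s, ltrm c y (natStr t) (encode (P s)) := ENNReal.sum_le_tsum _
    _ ≤ _ := ENNReal.tsum_comp_le_tsum_of_injective hinj _

end RelExt

/-- There is a constant `c` such that for every integer `t`,
every `δ ≥ 0` and every string (or tuple) `y` with `|y| < 2^t/2 − c`:
`m(y | t) ≥ (1/c) · |T_t^δ(y)| · 2^{−2^t − cδ}`,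
where `T_t^δ(y) = {s : C_V(y, s) ≤ 2^t + δ}`. -/
theorem measure_ge_relaxed_extension_density
    (O : OptimalDecompressor) (M : UniversalCondSemimeasure) :
    ∃ c : ℕ, 0 < c ∧ ∀ t δ : ℕ, ∀ y : BStr, 2 * (y.length + c) < 2 ^ t →
      ((TsetR O t δ y).ncard : ℝ≥0∞) / ((c : ℝ≥0∞) * 2 ^ (2 ^ t + c * δ)) ≤
        M.μ y (natStr t) := by
  obtain ⟨c, hc⟩ := RelExt.exists_nu O
  obtain ⟨k, hk, hdom⟩ := M.dominates (RelExt.nu c)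
  refine ⟨4 * k, by omega, fun t δ y _ => ?_⟩
  have h1 := (RelExt.lower O c hc t δ y).trans (hdom y (natStr t))
  have hk0 : (k : ℝ≥0∞) ≠ 0 := by exact_mod_cast hk.ne'
  have hkt : (k : ℝ≥0∞) ≠ ⊤ := ENNReal.natCast_ne_top k
  have h2 : ((TsetR O t δ y).ncard : ℝ≥0∞) ≤
      (k : ℝ≥0∞) * M.μ y (natStr t) * 2 ^ (2 ^ t + 2 * δ + 2) := by
    rw [← ENNReal.div_le_iff (by simp) (by simp), ENNReal.div_eq_inv_mul, mul_comm,
      ENNReal.inv_pow]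
    exact h1
  refine ENNReal.div_le_of_le_mul (h2.trans ?_)
  have h3 : (2 : ℝ≥0∞) ^ (2 ^ t + 2 * δ + 2) ≤ 4 * 2 ^ (2 ^ t + 4 * k * δ) := by
    rw [pow_add _ _ 2, mul_comm, show (2 : ℝ≥0∞) ^ 2 = 4 by norm_num]
    gcongr
    · norm_num
    · omega
  calc _ ≤ (k : ℝ≥0∞) * M.μ y (natStr t) * (4 * 2 ^ (2 ^ t + 4 * k * δ)) := by gcongr
    _ = _ := by push_cast; ring
end

section
/- There exists a constant c such that for every integer t, every integer δ ≥ 0, and every string (or tuple) y with |y| < 2^t/2 − c: |T_t(y)| ≥ |T_t^δ(y)| · 2^{−cδ − c}, where T_t(y) = {s : C_V(y, s) ≤ 2^t} and T_t^δ(y) = {s : C_V(y, s) ≤ 2^t + δ}. -/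
open scoped Classical ENNReal

namespace RSV

/-- Value of a binary string, least significant bit first. -/
def bval (l : BStr) : ℕ := l.foldr (fun b n => (cond b 1 0) + 2 * n) 0

theorem bval_cons (b : Bool) (l : BStr) : bval (b :: l) = (cond b 1 0) + 2 * bval l := rfl

theorem bval_natStr (n : ℕ) : bval (natStr n) = n := by
  unfold natStr
  induction n using Nat.binaryRec' with
  | zero => simp [bval]
  | bit b n h ih =>
    rw [Nat.bits_append_bit _ _ h, bval_cons, ih, Nat.bit_val]
    cases b <;> simp [add_comm]

theorem natStr_inj {m n : ℕ} (h : natStr m = natStr n) : m = n := by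
  rw [← bval_natStr m, h, bval_natStr]

theorem pairStr_inj {y s y' s' : BStr} (h : pairStr y s = pairStr y' s') : (y, s) = (y', s') :=
  Encodable.encode_injective (natStr_inj h)

theorem bval_header (a : ℕ) (q : BStr) :
    bval (List.replicate a true ++ false :: q) / 2 ^ (a + 1) = bval q := by
  induction a with
  | zero => simp [bval_cons]
  | succ a ih =>
    rw [List.replicate_succ, List.cons_append, bval_cons, pow_succ', ← Nat.div_div_eq_div_mul]
    rw [← ih]
    congr 1
    simp; omega

theorem exists_bval (l i : ℕ) (h : i < 2 ^ l) : ∃ q : BStr, q.length = l ∧ bval q = i := by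
  induction l generalizing i with
  | zero => exact ⟨[], rfl, by simp [bval] at *; omega⟩
  | succ l ih =>
    obtain ⟨q, h1, h2⟩ := ih (i / 2) (by rw [pow_succ] at h; omega)
    refine ⟨(decide (i % 2 = 1)) :: q, by simp [h1], ?_⟩
    rw [bval_cons, h2]
    by_cases h : i % 2 = 1 <;> simp [h] <;> omega

/-- Injective value of a binary string. -/
def wval (l : BStr) : ℕ := l.foldr (fun b n => (cond b 1 0) + 2 * n) 1

theorem wval_cons (b : Bool) (l : BStr) : wval (b :: l) = (cond b 1 0) + 2 * wval l := rfl

theorem wval_pos (l : BStr) : 0 < wval l := by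
  induction l with
  | nil => simp [wval]
  | cons b l ih => rw [wval_cons]; omega

theorem wval_inj : Function.Injective wval := by
  intro l
  induction l with
  | nil =>
    intro l' h
    cases l' with
    | nil => rfl
    | cons b l' =>
      have := wval_pos l'
      rw [wval_cons] at h
      simp [wval] at h this
      cases b <;> simp at h <;> omega
  | cons b l ih =>
    intro l' h
    cases l' with
    | nil =>
      have := wval_pos l
      rw [wval_cons] at h
      simp [wval] at h this
      cases b <;> simp at h <;> omega
    | cons b' l' =>
      rw [wval_cons, wval_cons] at h
      cases b <;> cases b' <;> simp at h <;> first | omega | (rw [ih (by omega : wval l = wval l')])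

theorem wval_lt (l : BStr) : wval l < 2 ^ (l.length + 1) := by
  induction l with
  | nil => simp [wval]
  | cons b l ih =>
    rw [wval_cons, List.length_cons, pow_succ]
    cases b <;> simp <;> omega

theorem strs_finite (L : ℕ) : {p : BStr | p.length ≤ L}.Finite ∧
    {p : BStr | p.length ≤ L}.ncard ≤ 2 ^ (L + 1) := by
  have hm : Set.MapsTo wval {p : BStr | p.length ≤ L} (Set.Iio (2 ^ (L + 1))) := by
    intro p hp
    exact lt_of_lt_of_le (wval_lt p) (Nat.pow_le_pow_right (by norm_num) (by simpa using hp))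
  refine ⟨Set.Finite.of_injOn hm wval_inj.injOn (Set.finite_Iio _), ?_⟩
  have := Set.ncard_le_ncard_of_injOn wval hm wval_inj.injOn (Set.finite_Iio _)
  simpa [Set.ncard_eq_toFinset_card'] using this

theorem plainC_le_iff (O : OptimalDecompressor) (x : BStr) (L : ℕ) :
    plainC O.V x ≤ L ↔ ∃ p : BStr, p.length ≤ L ∧ x ∈ O.V p := by
  constructor
  · intro h
    obtain ⟨p, hp⟩ := O.onto x
    have : plainC O.V x ∈ {n | ∃ p : BStr, p.length = n ∧ x ∈ O.V p} :=
      Nat.sInf_mem ⟨_, p, rfl, hp⟩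
    obtain ⟨q, hq, hx⟩ := this
    exact ⟨q, hq ▸ h, hx⟩
  · rintro ⟨p, hp, hx⟩
    exact (Nat.sInf_le ⟨p, rfl, hx⟩ : plainC O.V x ≤ _).trans hp

theorem plainC_le (D : BStr →. BStr) (x p : BStr) (h : x ∈ D p) : plainC D x ≤ p.length :=
  Nat.sInf_le ⟨p, rfl, h⟩

theorem simple_finite (O : OptimalDecompressor) (L : ℕ) :
    {x | plainC O.V x ≤ L}.Finite ∧ {x | plainC O.V x ≤ L}.ncard ≤ 2 ^ (L + 1) := by
  have h : ∀ x, ∃ p : BStr, plainC O.V x ≤ L → p.length ≤ L ∧ x ∈ O.V p := by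
    intro x
    by_cases hx : plainC O.V x ≤ L
    · obtain ⟨p, hp⟩ := (plainC_le_iff O x L).1 hx
      exact ⟨p, fun _ => hp⟩
    · exact ⟨[], fun h => absurd h hx⟩
  choose f hf using h
  have hm : Set.MapsTo f {x | plainC O.V x ≤ L} {p : BStr | p.length ≤ L} :=
    fun x hx => (hf x hx).1
  have hi : Set.InjOn f {x | plainC O.V x ≤ L} := by
    intro x hx x' hx' h
    have h1 := (hf x hx).2
    have h2 := (hf x' hx').2
    rw [h] at h1
    exact Part.mem_unique h1 h2
  obtain ⟨h1, h2⟩ := strs_finite L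
  exact ⟨Set.Finite.of_injOn hm hi h1, (Set.ncard_le_ncard_of_injOn f hm hi h1).trans h2⟩

/-! Computability -/

theorem primrec_bval : Primrec bval :=
  Primrec.list_foldr (h := fun _ (p : Bool × ℕ) => (cond p.1 1 0) + 2 * p.2)
    Primrec.id (Primrec.const 0)
    (Primrec.nat_add.comp
      (Primrec.cond (Primrec.fst.comp Primrec.snd) (Primrec.const 1) (Primrec.const 0))
      (Primrec.nat_double.comp (Primrec.snd.comp Primrec.snd))).to₂

theorem primrec_natStr : Primrec natStr := by
  have : Primrec₂ (fun (_ : Unit) (n : ℕ) => natStr n) := by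
    refine Primrec.nat_strong_rec _ (g := fun _ l =>
      if l.length = 0 then some [] else
        (l[l.length / 2]?).map fun r => Nat.bodd l.length :: r) ?_ ?_
    · refine Primrec.ite (Primrec.eq.comp (Primrec.list_length.comp Primrec.snd) (Primrec.const 0))
        (Primrec.const _) ?_
      refine Primrec.option_map (Primrec.list_getElem?.comp Primrec.snd
        (Primrec.nat_div.comp (Primrec.list_length.comp Primrec.snd) (Primrec.const 2))) ?_
      exact Primrec.list_cons.comp
        (Primrec.nat_bodd.comp (Primrec.list_length.comp (Primrec.snd.comp Primrec.fst)))
        Primrec.snd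
    · intro _ n
      by_cases hn : n = 0
      · subst hn; simp [natStr]
      · have h2 : n / 2 < n := by omega
        have h3 : natStr n = n.bodd :: natStr (n / 2) := by
          have h := Nat.bits_append_bit n.div2 n.bodd (by
            intro h
            rw [Nat.div2_val] at h
            have : n = 1 := by omega
            subst this; rfl)
          rw [Nat.bit_bodd_div2, Nat.div2_val] at h
          exact h
        simp [hn, h2, h3]
  exact this.comp (Primrec.const ()) Primrec.id

theorem primrec_pairStr : Primrec (fun p : BStr × BStr => pairStr p.1 p.2) :=
  primrec_natStr.comp Primrec.encode

theorem primrec_two_pow : Primrec (fun n : ℕ => 2 ^ n) :=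
  (Primrec.nat_rec₁ 1 (f := fun _ r => 2 * r)
    (Primrec.nat_double.comp Primrec.snd).to₂).of_eq fun n => by
    induction n with
    | zero => rfl
    | succ n ih => simp only [ih, pow_succ]; ring

theorem primrec_count {α : Type*} [Primcodable α] {P : α → ℕ → Prop}
    [∀ a, DecidablePred (P a)] (hP : PrimrecRel P) :
    Primrec₂ fun a n => Nat.count (P a) n := by
  refine (Primrec.nat_rec (f := fun _ : α => 0)
    (g := fun a (p : ℕ × ℕ) => p.2 + if P a p.1 then 1 else 0) (Primrec.const 0) ?_).of_eq ?_
  · refine Primrec.nat_add.comp (Primrec.snd.comp Primrec.snd)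
      (Primrec.ite (hP.comp Primrec.fst (Primrec.fst.comp Primrec.snd))
        (Primrec.const 1) (Primrec.const 0))
  · intro a n
    induction n with
    | zero => simp
    | succ n ih => simp only [ih, Nat.count_succ]

theorem exists_enum (O : OptimalDecompressor) : ∃ R : ℕ → ℕ → Option (BStr × BStr),
    Primrec₂ R ∧ ∀ L y s, (∃ j, R L j = some (y, s)) ↔ plainC O.V (pairStr y s) ≤ L := by
  obtain ⟨c, hc⟩ := Nat.Partrec.Code.exists_code.1 O.partrec
  have hV : ∀ p x : BStr, x ∈ O.V p ↔
      Encodable.encode x ∈ Nat.Partrec.Code.eval c (Encodable.encode p) := by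
    intro p x
    rw [hc]
    simp
  let good : BStr → Option (BStr × BStr) := fun x =>
    (Encodable.decode (α := BStr × BStr) (bval x)).bind fun ys =>
      if pairStr ys.1 ys.2 = x then some ys else none
  have hgood : Primrec good := by
    refine Primrec.option_bind (Primrec.decode.comp primrec_bval) ?_
    exact Primrec.ite (Primrec.eq.comp (primrec_pairStr.comp Primrec.snd) Primrec.fst)
      (Primrec.option_some.comp Primrec.snd) (Primrec.const none)
  have good_iff : ∀ x y s, good x = some (y, s) ↔ x = pairStr y s := by
    intro x y s
    constructor
    · intro h
      simp only [good, Option.bind_eq_some_iff] at h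
      obtain ⟨ys, _, h2⟩ := h
      split_ifs at h2 with h3
      injection h2 with h2
      subst h2
      exact h3.symm
    · rintro rfl
      simp only [good]
      have : bval (pairStr y s) = Encodable.encode (y, s) := bval_natStr _
      rw [this, Encodable.encodek]
      simp
  let R : ℕ → ℕ → Option (BStr × BStr) := fun L j =>
    (Encodable.decode (α := BStr) j.unpair.2).bind fun p =>
      if p.length ≤ L then
        ((Nat.Partrec.Code.evaln j.unpair.1 c (Encodable.encode p)).bind
          fun e => (Encodable.decode (α := BStr) e).bind good)
      else none
  refine ⟨R, ?_, ?_⟩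
  · refine Primrec.option_bind (Primrec.decode.comp
      (Primrec.snd.comp (Primrec.unpair.comp Primrec.snd))) ?_
    refine Primrec.ite (Primrec.nat_le.comp (Primrec.list_length.comp Primrec.snd)
      (Primrec.fst.comp Primrec.fst)) ?_ (Primrec.const none)
    refine Primrec.option_bind (Nat.Partrec.Code.primrec_evaln.comp
      (Primrec.pair (Primrec.pair
        (Primrec.fst.comp (Primrec.unpair.comp (Primrec.snd.comp Primrec.fst)))
        (Primrec.const c)) (Primrec.encode.comp Primrec.snd))) ?_
    exact Primrec.option_bind (Primrec.decode.comp Primrec.snd)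
      (hgood.comp Primrec.snd).to₂
  · intro L y s
    rw [plainC_le_iff]
    constructor
    · rintro ⟨j, hj⟩
      simp only [R, Option.bind_eq_some_iff] at hj
      obtain ⟨p, _, h2⟩ := hj
      split_ifs at h2 with h3
      simp only [Option.bind_eq_some_iff] at h2
      obtain ⟨e, he, x, hx, hg⟩ := h2
      rw [good_iff] at hg
      subst hg
      refine ⟨p, h3, ?_⟩
      have he' := Nat.Partrec.Code.evaln_sound he
      rw [hc] at he'
      simp at he'
      obtain ⟨x', hx', rfl⟩ := he'
      simp at hx
      rw [← hx]; exact hx'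
    · rintro ⟨p, hp, hx⟩
      rw [hV, Nat.Partrec.Code.evaln_complete] at hx
      obtain ⟨k, hk⟩ := hx
      refine ⟨Nat.pair k (Encodable.encode p), ?_⟩
      simp only [R, Nat.unpair_pair, Encodable.encodek, Option.bind_some, hp, if_true]
      rw [Option.mem_def.1 hk]
      simp only [Encodable.encodek, Option.bind_some]
      exact (good_iff _ _ _).2 rfl

end RSV

namespace RSV

/-! Thinning of an enumeration -/

/-- `j` is the first moment where its (defined) value is listed. -/
def fresh (S : ℕ → Option (BStr × BStr)) (j : ℕ) : Prop :=
  S j ≠ none ∧ Nat.count (fun i => S i = S j) j = 0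

/-- First coordinate. -/
def key (S : ℕ → Option (BStr × BStr)) (j : ℕ) : Option BStr := (S j).map Prod.fst

/-- Number of earlier fresh entries with the same first coordinate. -/
noncomputable def cnt (S : ℕ → Option (BStr × BStr)) (j : ℕ) : ℕ :=
  Nat.count (fun i => fresh S i ∧ key S i = key S j) j

/-- Keep the last entry in every block of `m` entries with the same first coordinate. -/
def kept (S : ℕ → Option (BStr × BStr)) (m j : ℕ) : Prop :=
  fresh S j ∧ (cnt S j + 1) % m = 0

theorem fresh_inj {S : ℕ → Option (BStr × BStr)} {i j : ℕ} (hi : fresh S i) (hj : fresh S j)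
    (h : S i = S j) : i = j := by
  have h1 := Nat.count_iff_forall_not.1 hi.2
  have h2 := Nat.count_iff_forall_not.1 hj.2
  rcases lt_trichotomy i j with hl | hl | hl
  · exact absurd h (h2 i hl)
  · exact hl
  · exact absurd h.symm (h1 j hl)

theorem exists_fresh {S : ℕ → Option (BStr × BStr)} {x : BStr × BStr} (h : ∃ j, S j = some x) :
    ∃ j, fresh S j ∧ S j = some x := by
  refine ⟨Nat.find h, ⟨?_, ?_⟩, Nat.find_spec h⟩
  · rw [Nat.find_spec h]; simp
  · rw [Nat.count_iff_forall_not]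
    intro i hi
    rw [Nat.find_spec h]
    exact Nat.find_min h hi

theorem count_kept_key (S : ℕ → Option (BStr × BStr)) (m : ℕ) (κ : Option BStr) (n : ℕ) :
    Nat.count (fun i => kept S m i ∧ key S i = κ) n =
      Nat.count (fun i => fresh S i ∧ key S i = κ) n / m := by
  induction n with
  | zero => simp
  | succ n ih =>
    rw [Nat.count_succ, Nat.count_succ, ih]
    by_cases hk : key S n = κ
    · by_cases hf : fresh S n
      · have : kept S m n ↔ m ∣ Nat.count (fun i => fresh S i ∧ key S i = κ) n + 1 := by
          subst hk
          simp only [kept, hf, true_and, cnt]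
          exact (Nat.dvd_iff_mod_eq_zero).symm
        simp only [hk, hf, this, and_true, if_true]
        rw [Nat.succ_div]
      · simp [hf, kept]
    · simp [hk]

theorem count_kept_le (S : ℕ → Option (BStr × BStr)) (m : ℕ) (n : ℕ) :
    m * Nat.count (kept S m) n ≤ Nat.count (fresh S) n := by
  have key_sum : ∀ P : ℕ → Prop, Nat.count P n =
      ∑ κ ∈ (Finset.range n).image (key S), Nat.count (fun i => P i ∧ key S i = κ) n := by
    intro P
    rw [Nat.count_eq_card_filter_range]
    rw [Finset.card_eq_sum_card_fiberwise (f := key S) (t := (Finset.range n).image (key S))]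
    · refine Finset.sum_congr rfl fun κ _ => ?_
      rw [Nat.count_eq_card_filter_range, Finset.filter_filter]
    · intro i hi
      simp only [Finset.coe_filter, Set.mem_ofPred_eq] at hi
      simp only [Finset.coe_image]
      exact ⟨i, by simpa using hi.1, rfl⟩
  rw [key_sum (kept S m), key_sum (fresh S), Finset.mul_sum]
  refine Finset.sum_le_sum fun κ _ => ?_
  rw [count_kept_key]
  exact Nat.mul_div_le _ _

theorem count_fresh_le (S : ℕ → Option (BStr × BStr)) (n : ℕ)
    (hf : {x | ∃ j, S j = some x}.Finite) :
    Nat.count (fresh S) n ≤ {x | ∃ j, S j = some x}.ncard := by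
  rw [Nat.count_eq_card_filter_range, ← Set.ncard_coe_finset]
  refine Set.ncard_le_ncard_of_injOn (fun j => (S j).getD ([], [])) ?_ ?_ hf
  · intro j hj
    simp only [Finset.coe_filter, Set.mem_ofPred_eq] at hj
    obtain ⟨x, hx⟩ := Option.ne_none_iff_exists'.1 hj.2.1
    exact ⟨j, by simp [hx]⟩
  · intro i hi j hj h
    simp only [Finset.coe_filter, Set.mem_ofPred_eq] at hi hj
    obtain ⟨x, hx⟩ := Option.ne_none_iff_exists'.1 hi.2.1
    obtain ⟨x', hx'⟩ := Option.ne_none_iff_exists'.1 hj.2.1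
    simp only [hx, hx', Option.getD_some] at h
    exact fresh_inj hi.2 hj.2 (by rw [hx, hx', h])

theorem kept_many (S : ℕ → Option (BStr × BStr)) (m : ℕ) (y : BStr) (A : Set BStr)
    (hf : {s | ∃ j, S j = some (y, s)}.Finite)
    (hA : A.Finite) (h : ∀ j s, kept S m j → S j = some (y, s) → s ∈ A) :
    {s | ∃ j, S j = some (y, s)}.ncard / m ≤ A.ncard := by
  have : ∀ s, ∃ j, (∃ j, S j = some (y, s)) → fresh S j ∧ S j = some (y, s) := by
    intro s
    by_cases hs : ∃ j, S j = some (y, s)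
    · obtain ⟨j, hj⟩ := exists_fresh hs
      exact ⟨j, fun _ => hj⟩
    · exact ⟨0, fun h => absurd h hs⟩
  choose f hfr using this
  obtain ⟨n, hn⟩ : ∃ n, ∀ s ∈ {s | ∃ j, S j = some (y, s)}, f s < n := by
    obtain ⟨b, hb⟩ := (hf.image f).bddAbove
    exact ⟨b + 1, fun s hs => Nat.lt_succ_of_le (hb ⟨s, hs, rfl⟩)⟩
  have h1 : {s | ∃ j, S j = some (y, s)}.ncard ≤
      Nat.count (fun i => fresh S i ∧ key S i = some y) n := by
    rw [Nat.count_eq_card_filter_range, ← Set.ncard_coe_finset]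
    refine Set.ncard_le_ncard_of_injOn f ?_ ?_ (Finset.finite_toSet _)
    · intro s hs
      simp only [Finset.coe_filter, Set.mem_ofPred_eq, Finset.mem_range]
      exact ⟨hn s hs, (hfr s hs).1, by simp [key, (hfr s hs).2]⟩
    · intro s hs s' hs' he
      have h1 := (hfr s hs).2
      have h2 := (hfr s' hs').2
      rw [he, h2] at h1
      simpa using h1.symm
  refine (Nat.div_le_div_right h1).trans ?_
  rw [← count_kept_key, Nat.count_eq_card_filter_range, ← Set.ncard_coe_finset]
  have hS : ∀ j, key S j = some y → ∃ s, S j = some (y, s) := by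
    intro j hj
    simp only [key, Option.map_eq_some_iff] at hj
    obtain ⟨⟨y', s⟩, h1, h2⟩ := hj
    exact ⟨s, by rw [h1, ← h2]⟩
  refine Set.ncard_le_ncard_of_injOn (fun j => ((S j).getD ([], [])).2) ?_ ?_ hA
  · intro j hj
    simp only [Finset.coe_filter, Set.mem_ofPred_eq] at hj
    obtain ⟨s, hs⟩ := hS j hj.2.2
    exact h j _ hj.2.1 (by simp [hs])
  · intro i hi j hj he
    simp only [Finset.coe_filter, Set.mem_ofPred_eq] at hi hj
    obtain ⟨s, hs⟩ := hS i hi.2.2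
    obtain ⟨s', hs'⟩ := hS j hj.2.2
    simp only [hs, hs', Option.getD_some] at he
    exact fresh_inj hi.2.1.1 hj.2.1.1 (by rw [hs, hs', he])

section
variable {α : Type*} [Primcodable α] {S : α → ℕ → Option (BStr × BStr)}

theorem primrec_fresh (hS : Primrec₂ S) : PrimrecRel fun a j => fresh (S a) j := by
  have h1 : PrimrecRel fun (b : α × ℕ) (i : ℕ) => S b.1 i = S b.1 b.2 :=
    Primrec.eq.comp (hS.comp (Primrec.fst.comp Primrec.fst) Primrec.snd)
      (hS.comp (Primrec.fst.comp Primrec.fst) (Primrec.snd.comp Primrec.fst))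
  exact PrimrecPred.and
    (PrimrecPred.not (Primrec.eq.comp (hS.comp Primrec.fst Primrec.snd) (Primrec.const none)))
    (Primrec.eq.comp ((primrec_count h1).comp Primrec.id Primrec.snd) (Primrec.const 0))

theorem primrec_key (hS : Primrec₂ S) : Primrec₂ fun a j => key (S a) j :=
  Primrec.option_map hS (Primrec.fst.comp Primrec.snd).to₂

theorem primrec_cnt (hS : Primrec₂ S) : Primrec₂ fun a j => cnt (S a) j := by
  have h1 : PrimrecRel fun (b : α × ℕ) (i : ℕ) =>
      fresh (S b.1) i ∧ key (S b.1) i = key (S b.1) b.2 :=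
    PrimrecPred.and ((primrec_fresh hS).comp (Primrec.fst.comp Primrec.fst) Primrec.snd)
     (Primrec.eq.comp ((primrec_key hS).comp (Primrec.fst.comp Primrec.fst) Primrec.snd)
      ((primrec_key hS).comp (Primrec.fst.comp Primrec.fst) (Primrec.snd.comp Primrec.fst)))
  exact (primrec_count h1).comp Primrec.id Primrec.snd

theorem primrec_kept (hS : Primrec₂ S) {m : α → ℕ} (hm : Primrec m) :
    PrimrecRel fun a j => kept (S a) (m a) j :=
  PrimrecPred.and (primrec_fresh hS)
    (Primrec.eq.comp (Primrec.nat_mod.comp (Primrec.succ.comp (primrec_cnt hS))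
      (hm.comp Primrec.fst)) (Primrec.const 0))

end

/-- The main decompressor. -/
theorem exists_decompressor (R : ℕ → ℕ → Option (BStr × BStr)) (hR : Primrec₂ R) :
    ∃ D : BStr →. BStr, Partrec D ∧ ∀ (a : ℕ) (q : BStr) (j : ℕ) (y s : BStr),
      kept (R (q.length + 3 * a + 1)) (2 ^ (3 * a + 2)) j →
      R (q.length + 3 * a + 1) j = some (y, s) →
      Nat.count (kept (R (q.length + 3 * a + 1)) (2 ^ (3 * a + 2))) j = bval q →
      pairStr y s ∈ D (List.replicate a true ++ false :: q) := by
  let hd : BStr → ℕ := fun p => p.findIdx (fun b => !b)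
  have hhd : Primrec hd := Primrec.list_findIdx Primrec.id (Primrec.not.comp Primrec.snd).to₂
  let Lf : BStr → ℕ := fun p => (p.length - (hd p + 1)) + 3 * hd p + 1
  have hLf : Primrec Lf := Primrec.succ.comp (Primrec.nat_add.comp
    (Primrec.nat_sub.comp Primrec.list_length (Primrec.succ.comp hhd))
    (Primrec.nat_mul.comp (Primrec.const 3) hhd))
  let mf : BStr → ℕ := fun p => 2 ^ (3 * hd p + 2)
  have hmf : Primrec mf := primrec_two_pow.comp (Primrec.nat_add.comp
    (Primrec.nat_mul.comp (Primrec.const 3) hhd) (Primrec.const 2))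
  let xf : BStr → ℕ := fun p => bval p / 2 ^ (hd p + 1)
  have hxf : Primrec xf := Primrec.nat_div.comp primrec_bval
    (primrec_two_pow.comp (Primrec.succ.comp hhd))
  have hS : Primrec₂ (fun p j => R (Lf p) j) :=
    hR.comp (hLf.comp Primrec.fst) Primrec.snd
  have hk := primrec_kept hS hmf
  let F : BStr → ℕ → Option BStr := fun p j =>
    if kept (R (Lf p)) (mf p) j ∧ Nat.count (kept (R (Lf p)) (mf p)) j = xf p then
      (R (Lf p) j).map (fun z => pairStr z.1 z.2) else none
  have hF : Primrec₂ F := by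
    refine Primrec.ite (PrimrecPred.and hk (Primrec.eq.comp (primrec_count hk)
      (hxf.comp Primrec.fst))) ?_ (Primrec.const none)
    exact Primrec.option_map hS (primrec_pairStr.comp Primrec.snd).to₂
  refine ⟨fun p => Nat.rfindOpt (F p), Partrec.rfindOpt hF.to_comp, ?_⟩
  intro a q j y s h1 h2 h3
  have e1 : hd (List.replicate a true ++ false :: q) = a := by
    simp only [hd]
    clear h1 h2 h3
    induction a with
    | zero => simp [List.findIdx_cons]
    | succ a ih => simp [List.replicate_succ, List.findIdx_cons, ih]
  have e2 : Lf (List.replicate a true ++ false :: q) = q.length + 3 * a + 1 := by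
    simp only [Lf, e1]; simp; omega
  have e3 : mf (List.replicate a true ++ false :: q) = 2 ^ (3 * a + 2) := by
    simp only [mf, e1]
  have e4 : xf (List.replicate a true ++ false :: q) = bval q := by
    simp only [xf, e1]; exact bval_header a q
  have hFj : F (List.replicate a true ++ false :: q) j = some (pairStr y s) := by
    simp only [F, e2, e3, e4]
    rw [if_pos ⟨h1, h3⟩, h2]; rfl
  obtain ⟨x, hx⟩ := Part.dom_iff_mem.1 (Nat.rfindOpt_dom.2 ⟨j, _, hFj⟩)
  obtain ⟨i, hi⟩ := Nat.rfindOpt_spec hx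
  have hij : i = j := by
    simp only [F, e2, e3, e4] at hi
    split_ifs at hi with hc
    · exact Nat.count_injective hc.1 h1 (hc.2.trans h3.symm)
    · simp at hi
  subst hij
  rw [hFj] at hi
  rw [Option.mem_def] at hi
  injection hi with hi
  rw [hi]; exact hx

theorem main (O : OptimalDecompressor) :
    ∃ c : ℕ, ∀ t δ : ℕ, ∀ y : BStr, 2 * (y.length + c) < 2 ^ t →
      (TsetR O t δ y).ncard ≤ (Tset O t y).ncard * 2 ^ (c * δ + c) := by
  obtain ⟨R, hR, hRs⟩ := exists_enum O
  obtain ⟨D, hD, hDs⟩ := exists_decompressor R hR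
  obtain ⟨M, hM⟩ := O.optimal D hD
  have hD0 : Partrec (fun y : BStr => (Part.some (pairStr y []) : Part BStr)) :=
    (primrec_pairStr.comp (Primrec.pair Primrec.id (Primrec.const []))).to_comp
  obtain ⟨M', hM'⟩ := O.optimal _ hD0
  refine ⟨3 * M + 3 + M', ?_⟩
  intro t δ y hy
  generalize hn : 2 ^ t = n at hy
  obtain ⟨a, ha⟩ : ∃ a, a = δ + M := ⟨_, rfl⟩
  have pinj : ∀ L, Set.InjOn (pairStr y) {s | plainC O.V (pairStr y s) ≤ L} := by
    intro L s _ s' _ h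
    simpa using pairStr_inj h
  have pmaps : ∀ L, Set.MapsTo (pairStr y) {s | plainC O.V (pairStr y s) ≤ L}
    {x | plainC O.V x ≤ L} := fun L s hs => hs
  have fin : ∀ L, {s | plainC O.V (pairStr y s) ≤ L}.Finite := fun L =>
    Set.Finite.of_injOn (pmaps L) (pinj L) (simple_finite O L).1
  have card : ∀ L, {s | plainC O.V (pairStr y s) ≤ L}.ncard ≤ 2 ^ (L + 1) := fun L =>
    (Set.ncard_le_ncard_of_injOn _ (pmaps L) (pinj L) (simple_finite O L).1).trans
      (simple_finite O L).2
  have hT : Tset O t y = {s | plainC O.V (pairStr y s) ≤ n} := by simp [Tset, hn]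
  have hTR : TsetR O t δ y ⊆ {s | plainC O.V (pairStr y s) ≤ n + a} := by
    intro s hs
    simp only [TsetR, hn, Set.mem_ofPred_eq] at hs ⊢
    omega
  have hpos : 0 < (Tset O t y).ncard := by
    rw [hT, Set.ncard_pos (fin n)]
    refine ⟨[], ?_⟩
    have h1 := hM' (pairStr y []) ⟨y, Part.mem_some _⟩
    have h2 := plainC_le (fun y : BStr => (Part.some (pairStr y []) : Part BStr))
      (pairStr y []) y (Part.mem_some _)
    simp only [Set.mem_ofPred_eq]
    omega
  have hle := Set.ncard_le_ncard hTR (fin (n + a))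
  have hexp : 2 ^ (3 * a + 3) ≤ 2 ^ ((3 * M + 3 + M') * δ + (3 * M + 3 + M')) := by
    refine Nat.pow_le_pow_right (by norm_num) ?_
    rw [ha]; nlinarith [Nat.zero_le (M * δ), Nat.zero_le (M' * δ)]
  refine hle.trans (le_trans ?_ (Nat.mul_le_mul_left _ hexp))
  by_cases hna : n < 2 * a + 1
  · calc _ ≤ 2 ^ (n + a + 1) := card _
      _ ≤ 2 ^ (3 * a + 3) := Nat.pow_le_pow_right (by norm_num) (by omega)
      _ ≤ _ := Nat.le_mul_of_pos_left _ hpos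
  · obtain ⟨l, hl⟩ : ∃ l, n = l + 2 * a + 1 := ⟨n - (2 * a + 1), by omega⟩
    have hL : n + a = l + 3 * a + 1 := by omega
    have hset : {s | ∃ j, R (n + a) j = some (y, s)} = {s | plainC O.V (pairStr y s) ≤ n + a} := by
      ext s; exact hRs _ _ _
    have hall : {x | ∃ j, R (n + a) j = some x} =
        {x : BStr × BStr | plainC O.V (pairStr x.1 x.2) ≤ n + a} := by
      ext ⟨y, s⟩; exact hRs _ _ _
    have ginj : Set.InjOn (fun x : BStr × BStr => pairStr x.1 x.2)
        {x : BStr × BStr | plainC O.V (pairStr x.1 x.2) ≤ n + a} :=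
      fun x _ x' _ h => pairStr_inj h
    have gmaps : Set.MapsTo (fun x : BStr × BStr => pairStr x.1 x.2)
        {x : BStr × BStr | plainC O.V (pairStr x.1 x.2) ≤ n + a}
        {x | plainC O.V x ≤ n + a} := fun x hx => hx
    have gfin := Set.Finite.of_injOn gmaps ginj (simple_finite O (n + a)).1
    have gcard := (Set.ncard_le_ncard_of_injOn _ gmaps ginj (simple_finite O (n + a)).1).trans
      (simple_finite O (n + a)).2
    have hmain := kept_many (R (n + a)) (2 ^ (3 * a + 2)) y (Tset O t y)
      (by rw [hset]; exact fin _) (by rw [hT]; exact fin n) (by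
        intro j s hj hs
        have hc1 := count_kept_le (R (n + a)) (2 ^ (3 * a + 2)) (j + 1)
        have hc2 := count_fresh_le (R (n + a)) (j + 1) (by rw [hall]; exact gfin)
        rw [hall] at hc2
        have hc3 := Nat.count_strict_mono hj (Nat.lt_succ_self j)
        have hc4 : Nat.count (kept (R (n + a)) (2 ^ (3 * a + 2))) (j + 1) ≤ 2 ^ l := by
          have h := (hc1.trans hc2).trans gcard
          rw [show n + a + 1 = (3 * a + 2) + l by omega, pow_add 2 (3 * a + 2) l] at h
          exact Nat.le_of_mul_le_mul_left h (Nat.two_pow_pos _)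
        obtain ⟨q, hq1, hq2⟩ := exists_bval l _ (lt_of_lt_of_le hc3 hc4)
        have hmem := hDs a q j y s (by rw [hq1, ← hL]; exact hj) (by rw [hq1, ← hL]; exact hs)
          (by rw [hq1, ← hL]; exact hq2.symm)
        have h1 := hM _ ⟨_, hmem⟩
        have h2 := plainC_le D _ _ hmem
        rw [hT]
        simp only [Set.mem_ofPred_eq]
        simp only [List.length_append, List.length_replicate, List.length_cons] at h2
        omega)
    rw [hset] at hmain
    have hp : 0 < 2 ^ (3 * a + 2) := by positivity
    have h5 := Nat.lt_mul_of_div_lt (Nat.lt_succ_of_le hmain) hp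
    rw [pow_succ _ (3 * a + 2)]
    generalize 2 ^ (3 * a + 2) = d at *
    refine h5.le.trans ?_
    nlinarith [Nat.mul_le_mul_left d hpos]

end RSV

/-- Relaxed vs. strict volume: there is a constant `c` such that
for every `t`, every `δ ≥ 0` and every string (or tuple) `y` with
`|y| < 2^t/2 − c`: `|T_t(y)| ≥ |T_t^δ(y)| · 2^{−cδ − c}`. -/
theorem relaxed_vs_strict_volume (O : OptimalDecompressor) :
    ∃ c : ℕ, ∀ t δ : ℕ, ∀ y : BStr, 2 * (y.length + c) < 2 ^ t →
      (TsetR O t δ y).ncard ≤ (Tset O t y).ncard * 2 ^ (c * δ + c) := by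
  exact RSV.main O
end
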